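/- arXiv:2112.12111 — 2 statements merged into one kernel-verified Lean document; each statement's English description precedes it below -/
import Mathlib

section
/- Let A be the companion matrix of f(x) = (x−1)⁴(x²+1) and B the companion matrix of the seventh cyclotomic polynomial g(x) = x⁶+x⁵+x⁴+x³+x²+x+1, regarded as elements of GL₆(ℚ), and set T = B·A⁻¹. Then B⁷ = I, B ≠ I, T has infinite order, and the group homomorphism from the free product ℤ ∗ (ℤ/7ℤ) to GL₆(ℚ) sending the generator 1 of ℤ to T and the generator 1 of ℤ/7ℤ to B is injective; in particular the group ⟨A,B⟩ is isomorphic to ℤ ∗ ℤ/7ℤ. (This is the hypergeometric monodromy group of case C-19, with α = (0,0,0,0,1/4,3/4) and β = (1/7,2/7,3/7,4/7,5/7,6/7).) -/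
open Matrix Polynomial

/-- The companion matrix of a (monic degree `n`) polynomial `p`:
the `n × n` matrix with subdiagonal entries `1`, last column
`(-c₀, …, -c_{n-1})ᵀ`, and `0` elsewhere. -/
def companionMatrix {K : Type*} [CommRing K] (n : ℕ) (p : Polynomial K) :
    Matrix (Fin n) (Fin n) K :=
  Matrix.of fun i j =>
    if (j : ℕ) + 1 = n then -p.coeff i
    else if (i : ℕ) = (j : ℕ) + 1 then 1 else 0

namespace HypergeometricC19

/-! ### Reduced words in a coproduct of two groups -/

section ReducedWords

variable {G H : Type*} [Group G] [Group H]

open Monoid.Coprod in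
/-- Products of pairs `inl g * inr h` with `g ≠ 1` and `h ≠ 1`. -/
inductive IsReduced : Monoid.Coprod G H → Prop
  | one : IsReduced 1
  | mul {g : G} {h : H} {s : Monoid.Coprod G H} (hg : g ≠ 1) (hh : h ≠ 1) (hs : IsReduced s) :
      IsReduced (inl g * inr h * s)

open Monoid.Coprod in
theorem exists_isReduced (x : Monoid.Coprod G H) :
    ∃ (h : H) (s : Monoid.Coprod G H) (g : G), IsReduced s ∧ x = inr h * s * inl g := by
  induction x using Monoid.Coprod.induction_on' with
  | one => exact ⟨1, 1, 1, .one, by simp⟩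
  | inr_mul k x ih =>
    obtain ⟨h, s, g, hs, rfl⟩ := ih
    exact ⟨k * h, s, g, hs, by simp [mul_assoc]⟩
  | inl_mul k x ih =>
    obtain ⟨h, s, g, hs, rfl⟩ := ih
    by_cases hk : k = 1
    · exact ⟨h, s, g, hs, by simp [hk]⟩
    by_cases hh : h = 1
    · subst hh
      cases hs with
      | one => exact ⟨1, 1, k * g, .one, by simp⟩
      | @mul g' h' s' hg' hh' hs' =>
        by_cases hkg : k * g' = 1
        · refine ⟨h', s', g, hs', ?_⟩
          have : (inl k : Monoid.Coprod G H) * inl g' = 1 := by rw [← map_mul, hkg, map_one]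
          simp only [map_one, one_mul, ← mul_assoc, this]
        · exact ⟨1, _, g, .mul hkg hh' hs', by simp [mul_assoc]⟩
    · exact ⟨1, _, g, .mul hk hh hs, by simp [mul_assoc]⟩

end ReducedWords

/-! ### The generators as integer matrices -/

/-- The `k`-th power of the companion matrix of the seventh cyclotomic polynomial. -/
def cyclotomicPow (k : ℕ) : Matrix (Fin 6) (Fin 6) ℤ := fun i j =>
  if (j + k) % 7 = 6 then -1 else if (i : ℕ) = (j + k) % 7 then 1 else 0

theorem cyclotomicPow_mod (k : ℕ) : cyclotomicPow (k % 7) = cyclotomicPow k := by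
  ext i j
  simp [cyclotomicPow]

theorem cyclotomicPow_mul_one (k : ℕ) :
    cyclotomicPow k * cyclotomicPow 1 = cyclotomicPow (k + 1) := by
  have h : ∀ m < 7, cyclotomicPow m * cyclotomicPow 1 = cyclotomicPow (m + 1) := by
    decide +kernel
  rw [← cyclotomicPow_mod k, h _ (Nat.mod_lt _ (by norm_num)), ← cyclotomicPow_mod (k + 1),
    ← cyclotomicPow_mod (k % 7 + 1), Nat.mod_add_mod]

/-- The direction of the transvection `T = 1 + direction ⊗ e₀`. -/
def direction : Fin 6 → ℤ := ![0, 5, -6, 9, -6, 5]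

/-- The matrix of `v ↦ (-1) ^ k • (ε • w + w 0 • direction)`, where `w = B ^ k v`. -/
def stepMatrix (k : ℕ) (ε : ℤ) : Matrix (Fin 6) (Fin 6) ℤ := fun i j =>
  (-1) ^ k * (ε * cyclotomicPow k i j + cyclotomicPow k 0 j * direction i)

/-! ### An invariant polyhedral cone -/

/-- The linear forms that cut out the invariant cone. -/
def coneForms : Fin 54 → Fin 6 → ℤ := ![
    ![1, 1, 1, 1, 1, 1], ![-6, 1, 1, 1, 1, 1], ![0, 30, -8, -9, -5, -6],
    ![-2, -6, -5, -9, -8, 30], ![10, -1, 5, -5, -39, 15], ![15, 15, -39, -5, 5, -1],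
    ![-6, -16, -8, 39, 4, -9], ![-16, -8, 39, 4, -9, 246], ![-8, 39, 4, -9, 246, 790],
    ![-254, 244, -16, -8, 39, 4], ![-4, -9, 4, 39, -8, -16], ![-9, 4, 39, -8, -16, 244],
    ![-256, 246, -9, 4, 39, -8], ![-1062, 790, 246, -9, 4, 39], ![7, 3, 13, 7, -33, -2],
    ![3, 13, 7, -33, -2, 193], ![13, 7, -33, -2, 193, 522], ![-8, -1, 36, 103, 200, 327],
    ![-183, 195, 3, 13, 7, -33], ![5, -2, -33, 7, 13, 3], ![-2, -33, 7, 13, 3, 195],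
    ![-181, 193, -2, -33, 7, 13], ![-700, 522, 193, -2, -33, 7], ![-657, 327, 200, 103, 36, -1],
    ![-12, 41, 1, -6, -4, -11], ![41, 1, -6, -4, -11, 105], ![2, -13, 26, 119, 266, 467],
    ![-123, 102, 41, 1, -6, -4], ![-300, 166, 102, 41, 1, -6], ![-555, 251, 166, 102, 41, 1],
    ![-9, -11, -4, -6, 1, 41], ![-11, -4, -6, 1, 41, 102], ![-4, -6, 1, 41, 102, 166],
    ![-6, 1, 41, 102, 166, 251], ![-126, 105, -11, -4, -6, 1], ![-867, 467, 266, 119, 26, -13],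
    ![8, 2, 1, -1, 1, 19], ![2, 1, -1, 1, 19, 54], ![-2586, 1351, 775, 355, 91, -17],
    ![-171, 61, 48, 35, 22, 9], ![-30, 19, 1, -1, 1, 2], ![31, -17, 91, 355, 775, 1351],
    ![-4, 9, 22, 35, 48, 61], ![-76, 54, 19, 1, -1, 1], ![2, -1, 2, -12, -21, 26],
    ![-1, 2, -12, -21, 26, 135], ![2, -12, -21, 26, 135, 283], ![-12, -21, 26, 135, 283, 492],
    ![-127, 133, -1, 2, -12, -21], ![4, 26, -21, -12, 2, -1], ![26, -21, -12, 2, -1, 133],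
    ![-129, 135, 26, -21, -12, 2], ![-413, 283, 135, 26, -21, -12],
    ![-903, 492, 283, 135, 26, -21]]

/-- The open polyhedral cone on which all `coneForms` are positive. -/
def cone : Set (Fin 6 → ℚ) := {v | ∀ i, 0 < ∑ j, (coneForms i j : ℚ) * v j}

/-- A Farkas certificate for the invariance of `cone` under `M`: each linear form of the cone,
composed with `M`, is up to scaling the listed positive combination of linear forms. -/
def Certifies (M : Matrix (Fin 6) (Fin 6) ℤ) (c : Fin 54 → ℕ × List (ℕ × Fin 54)) : Prop :=
  ∀ i, 0 < (c i).1 ∧ (c i).2 ≠ [] ∧ (∀ p ∈ (c i).2, 0 < p.1) ∧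
    ∀ j, (c i).1 * ∑ k, coneForms i k * M k j =
      ((c i).2.map fun p => (p.1 : ℤ) * coneForms p.2 j).sum

instance (M : Matrix (Fin 6) (Fin 6) ℤ) (c : Fin 54 → ℕ × List (ℕ × Fin 54)) :
    Decidable (Certifies M c) := by
  unfold Certifies
  infer_instance

theorem Certifies.mulVec_mem_cone {M : Matrix (Fin 6) (Fin 6) ℤ}
    {c : Fin 54 → ℕ × List (ℕ × Fin 54)} (h : Certifies M c) {v : Fin 6 → ℚ} (hv : v ∈ cone) :
    M.map (Int.cast : ℤ → ℚ) *ᵥ v ∈ cone := by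
  intro i
  obtain ⟨hd, hne, hpos, heq⟩ := h i
  have hcomb : ∀ l : List (ℕ × Fin 54),
      ∑ j, (((l.map fun p => (p.1 : ℤ) * coneForms p.2 j).sum : ℤ) : ℚ) * v j =
        (l.map fun p => (p.1 : ℚ) * ∑ j, (coneForms p.2 j : ℚ) * v j).sum := by
    intro l
    induction l with
    | nil => simp
    | cons p l ih =>
      simp only [List.map_cons, List.sum_cons, Int.cast_add, add_mul, Finset.sum_add_distrib, ih,
        Finset.mul_sum, Int.cast_mul, Int.cast_natCast, mul_assoc]
  have hsum : ((c i).1 : ℚ) * ∑ j, (coneForms i j : ℚ) * (M.map (Int.cast : ℤ → ℚ) *ᵥ v) j =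
      ∑ j, (((c i).1 * ∑ k, coneForms i k * M k j : ℤ) : ℚ) * v j := by
    simp only [mulVec, dotProduct, Matrix.map_apply, Finset.mul_sum, Int.cast_mul, Int.cast_sum,
      Finset.sum_mul, Int.cast_natCast]
    rw [Finset.sum_comm]
    simp only [mul_assoc]
  have hpos' : 0 < ((c i).1 : ℚ) *
      ∑ j, (coneForms i j : ℚ) * (M.map (Int.cast : ℤ → ℚ) *ᵥ v) j := by
    rw [hsum]
    simp only [heq]
    rw [hcomb]
    refine List.sum_pos _ ?_ (by simpa using hne)
    intro x hx
    obtain ⟨p, hp, rfl⟩ := List.mem_map.1 hx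
    exact mul_pos (by exact_mod_cast hpos p hp) (hv p.2)
  exact pos_of_mul_pos_right hpos' (Nat.cast_nonneg _)

def certificatePos1 : Fin 54 → ℕ × List (ℕ × Fin 54) := ![

    (37091527181, [(2457625555, 4), (602326543, 5), (262899766, 16), (598305677, 20), (4677557632, 30), (244648792, 34)]),
    (365145618426, [(66157007717, 3), (4324663685, 6), (128659629, 9), (1029176734, 19), (326223872, 29), (852145087, 46)]),
    (327394134275, [(22526687285, 5), (11677792691, 7), (5967644006, 8), (9069552469, 13), (5040879031, 15), (154198208718, 20)]),
    (126755040380, [(68473317842, 4), (32935582765, 10), (4311498200, 11), (30280733393, 20), (3660359315, 22), (69979411366, 25)]),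
    (215796228826, [(183742408391, 10), (7658667972, 18), (152906636163, 20), (3143422079, 22), (185831430400, 25), (21909347758, 34)]),
    (430040138957, [(326833780344, 5), (3172160848, 10), (363072909274, 11), (41053680837, 18), (61964691026, 24), (5923739446, 41)]),
    (469948577531, [(512703877144, 5), (71702041717, 15), (12574424030, 16), (403360445464, 20), (42314568499, 21), (193065932562, 25)]),
    (1725274590559, [(11002490969136, 4), (126672123007, 9), (68236137549, 13), (1541205866362, 30), (143882931454, 38), (15168111457355, 50)]),
    (547280208703, [(12910233674094, 4), (5754966184384, 5), (4731027387809, 7), (305690527919, 8), (69062522599, 13), (9476044024187, 30)]),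
    (481135095376, [(1190924997091, 4), (467948359548, 5), (141344477294, 8), (93380084818, 13), (1092509833703, 20), (3760001452600, 30)]),
    (194369649219, [(4235986204, 13), (46619854785, 15), (2910899191, 16), (274050218307, 19), (131008068270, 20), (121024584946, 25)]),
    (455611413880, [(3019301597263, 4), (1039996725200, 5), (61678606700, 13), (36552369230, 15), (2427357043537, 20), (552007921674, 25)]),
    (5030563529886, [(6123257116248, 15), (88937064798, 16), (14989040496519, 20), (28902976317206, 30), (6955233634630, 34), (35027175457, 38)]),
    (53326295832, [(202087647927, 4), (153101633820, 5), (16265312850, 6), (356770060437, 20), (56595293155, 29), (1580406110539, 30)]),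
    (61459691698, [(16805968386, 4), (74348027363, 6), (17850778657, 7), (23451811387, 25), (4338584859, 34), (35600710897, 45)]),
    (7216948576, [(37100255367, 4), (1593053460, 5), (989528602, 12), (25385784581, 20), (2844246010, 21), (8053188586, 25)]),
    (174966876782, [(2521190352768, 4), (869676968718, 5), (927836933130, 15), (912388859491, 20), (498692898474, 30), (13902677181, 38)]),
    (30511006750, [(499866929367, 4), (94831796255, 5), (35327500118, 8), (459045756063, 30), (16787696316, 34), (5332550407, 50)]),
    (269821484010, [(17825592009, 4), (805527630288, 20), (858453550210, 30), (308241526226, 34), (1666409273, 38), (308541405120, 45)]),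
    (71731031897, [(13556173575, 5), (29784205970, 15), (846044556, 16), (10925381475, 18), (12280011197, 20), (45455441350, 25)]),
    (3306607520357, [(16040525224983, 4), (424827728579, 11), (371003350903, 13), (541407436428, 18), (64456145035, 38), (23550113694807, 50)]),
    (1045614749156, [(1212436473591, 4), (92773074114, 8), (133951081998, 13), (2274829389571, 20), (4669364030560, 30), (193300338048, 34)]),
    (130080632569, [(216754392506, 4), (144780973603, 5), (230819031637, 6), (534853027930, 20), (2686041740991, 30), (17638187477, 38)]),
    (3797767932, [(7457200389, 4), (1512999846, 6), (11193878568, 19), (6167435859, 20), (1236634123, 29), (73851855715, 30)]),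
    (19037646589547, [(515568720456, 9), (477602109816, 16), (6954766899768, 20), (16174448621531, 30), (192583505910, 38), (54923712044, 41)]),
    (30729845849, [(116855901895, 4), (63170834618, 6), (31861071401, 7), (34865389141, 25), (13251318544, 34), (70301532912, 45)]),
    (1220440270, [(28333932821, 4), (4815694065, 5), (2010121594, 8), (22916831709, 30), (1006985828, 34), (365525261, 50)]),
    (26006704334, [(3562901114, 4), (11523395390, 6), (16852456471, 20), (111531503532, 30), (1999366098, 34), (514216515, 38)]),
    (17089955694, [(12646466043, 4), (10263960312, 6), (18391548426, 19), (14450680155, 20), (2766585152, 29), (158823907358, 30)]),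
    (128903647362, [(274659724433, 4), (34007482447, 5), (307359811663, 6), (20290089205, 8), (42503480769, 9), (2534351252217, 30)]),
    (197277079558, [(40561107824, 3), (75189865328, 5), (249134323216, 14), (63427571962, 15), (61418149499, 20), (266072919, 38)]),
    (19915940618, [(53523295707, 4), (11308049598, 5), (18805193494, 15), (16815197309, 20), (12224166440, 30), (4269504972, 34)]),
    (152556897339, [(1242156156849, 4), (224944486605, 5), (84583610696, 8), (13180608507, 15), (28134059483, 21), (1016777295229, 30)]),
    (11979898619, [(121781164066, 4), (25718412364, 5), (28887665766, 20), (63120399699, 30), (7394361154, 34), (58019290512, 45)]),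
    (87483438391, [(37678399457, 4), (106305782258, 5), (56662068398, 15), (172453194607, 20), (87738790711, 30), (3941439466, 38)]),
    (34179911388, [(79573905483, 4), (26585078514, 6), (125085271344, 19), (87822405381, 20), (16568724785, 29), (872487388025, 30)]),
    (579460927784, [(336714166471, 4), (193156100122, 7), (58827902708, 15), (296016257668, 19), (30929169804, 30), (1088077489, 38)]),
    (39831881236, [(57267491617, 4), (13657579772, 5), (19479477922, 15), (25466980255, 20), (11242324018, 30), (5743603580, 34)]),
    (2441422242, [(18055944456, 4), (4853404698, 6), (26823652026, 19), (18113478006, 20), (3433717337, 29), (182442071933, 30)]),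
    (27622210149, [(17150099593, 4), (7730641088, 5), (12128426585, 6), (412856942, 8), (1931715909, 9), (156187352823, 30)]),
    (74020783904, [(8736464171, 4), (5696192476, 5), (262669630, 8), (1120431602, 13), (18748293967, 20), (38856235192, 30)]),
    (15255503375, [(1021985584601, 4), (171017507640, 5), (72376563604, 8), (850115331189, 30), (39443009198, 34), (25926720971, 50)]),
    (72509666151, [(251831750278, 4), (41748175636, 5), (2714151244, 15), (25684365698, 16), (304539640507, 30), (11097695047, 34)]),
    (390100565010, [(52463617944, 4), (64163545290, 6), (170583052533, 20), (839467719860, 30), (40274312116, 34), (3184124713, 38)]),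
    (24096201292, [(9819960944, 4), (2239518636, 7), (12791162509, 10), (7153965827, 20), (612313151, 22), (11117577498, 25)]),
    (50977395895, [(254030115513, 4), (9555628465, 8), (58175877152, 20), (9624847684, 25), (22346172690, 34), (28460161000, 45)]),
    (39831881236, [(300605687095, 4), (89091995996, 5), (124277672062, 15), (103407488657, 20), (95199689394, 30), (25187897384, 34)]),
    (15255503375, [(375942887818, 4), (67253650520, 5), (26832905247, 8), (303102066777, 30), (13101019189, 34), (5593930603, 50)]),
    (50678828746, [(18637324891, 4), (6153393542, 5), (22224380226, 12), (128086912599, 20), (117586227370, 30), (15067165874, 45)]),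
    (9055748715, [(1327945875, 6), (769709866, 9), (3887039164, 11), (250783555, 25), (45842230, 34), (1498137675, 45)]),
    (4239992940, [(11935398521, 4), (1067489000, 5), (283004790, 15), (10292566779, 20), (10254597038, 25), (3547847840, 34)]),
    (195050282505, [(61495941291, 4), (24204810825, 6), (269383138107, 20), (668436792395, 30), (26609429554, 34), (6532882117, 38)]),
    (8544977847, [(8778221232, 4), (6814302441, 6), (11361943491, 19), (17028658011, 20), (2786560820, 29), (104592919412, 30)]),
    (8544977847, [(20806967292, 4), (5046900351, 6), (37163205276, 19), (25909963077, 20), (4446341786, 29), (227577086726, 30)])]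

def certificateNeg1 : Fin 54 → ℕ × List (ℕ × Fin 54) := ![
    (1, [(1, 0)]),
    (2012352381, [(3561690, 11), (23680635, 14), (13246544, 15), (75140512, 25), (78957938, 42), (7178494, 51)]),
    (13150396, [(4500689, 3), (291115, 5), (4964089, 25), (8290636, 36), (267116, 45), (4983112, 50)]),
    (177571846191, [(1068835109, 20), (79125747415, 30), (1889535959, 39), (335857076, 41), (80633044340, 45), (21085221890, 46)]),
    (11039793720, [(521662470, 4), (7427653572, 15), (344275621, 25), (5067440089, 30), (10294720, 41), (7366855116, 45)]),
    (429586801, [(257254919, 20), (168451205, 30), (42539766, 36), (1324560, 41), (101687126, 44), (303446883, 50)]),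
    (1, [(1, 7)]), (1, [(1, 8)]),
    (1655309396, [(78946918437, 0), (198511182, 8), (3531889, 13), (243603805, 16), (5262317040, 32), (4415761138, 46)]),
    (14505588565, [(51003043292, 4), (2999436625, 16), (4508088670, 19), (6549522488, 20), (70591198366, 25), (2795482885, 41)]),
    (1, [(1, 11)]),
    (691327416, [(11215459897, 0), (354359492, 8), (1258713, 13), (140437527, 16), (471522104, 31), (917465798, 45)]),
    (1054860956048, [(878730824228, 10), (914991902814, 11), (16437752413, 18), (6220362051546, 25), (106003287753, 41), (612800317996, 50)]),
    (486365873, [(538020124, 15), (1174471861, 24), (8243249910, 25), (8053446687, 36), (2204211763, 42), (781167219, 49)]),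
    (1, [(1, 15)]), (1, [(1, 16)]),
    (1647424952, [(269791481, 6), (1984712846, 32), (446680856, 41), (2107076264, 46), (91737823, 47), (158814221, 50)]),
    (338, [(2455, 0), (65, 41), (1202, 42)]),
    (20191806493, [(65475857379, 4), (4189184894, 8), (4311328680, 11), (2888369655, 20), (80213698102, 25), (2321749895, 41)]),
    (1, [(1, 20)]),
    (1227502934, [(791944930, 8), (94499251, 11), (73377941, 15), (2979894092, 30), (18447342, 39), (892033909, 42)]),
    (6189471660638, [(633803733466, 16), (229713925791, 18), (1621590869022, 19), (2497951527454, 20), (29636484555764, 25), (327687493913, 41)]),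
    (602370924, [(89977569, 8), (232953867, 15), (1791791810, 24), (6236703827, 25), (10529707677, 36), (995608831, 42)]),
    (324773568, [(946009715, 14), (246304483, 15), (859154271, 24), (1344223202, 25), (7196384859, 36), (883600905, 42)]),
    (1, [(1, 25)]),
    (4896574136, [(3822096376, 15), (1367224988, 16), (169328766, 20), (721235195, 25), (7100558795, 30), (333206576, 41)]),
    (3031, [(2237, 17), (619, 41), (10174, 42)]),
    (434830608, [(33583965, 5), (42429930, 14), (258236347, 24), (668236423, 25), (2463027234, 36), (112780505, 42)]),
    (162386784, [(184096409, 14), (58465033, 15), (230881533, 24), (306912326, 25), (2037825393, 36), (155823483, 42)]),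
    (108257856, [(317351615, 14), (87364015, 15), (225087003, 24), (319050410, 25), (1926548871, 36), (275811309, 42)]),
    (1, [(1, 31)]), (1, [(1, 32)]), (1, [(1, 33)]),
    (169, [(3663, 0), (169, 30), (13, 41), (594, 42)]),
    (694713779640, [(54413841946, 8), (414031941669, 11), (40577873821, 21), (1431942745399, 25), (13386891271, 41), (974095924755, 50)]),
    (324773568, [(1112048623, 14), (356050463, 15), (1163522379, 24), (2065046410, 25), (9545389815, 36), (1062747069, 42)]),
    (1, [(1, 37)]),
    (179168976, [(88553869, 0), (7765692, 16), (40611264, 32), (4494713, 41), (3400416, 46), (1492308, 49)]),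
    (324773568, [(3232464305, 14), (1110683905, 15), (3374592981, 24), (6165989942, 25), (26708119593, 36), (3291410019, 42)]),
    (324773568, [(298131799, 14), (57187847, 15), (193328211, 24), (210179578, 25), (1556951583, 36), (300083829, 42)]),
    (37979665553878, [(547605634266, 8), (138173791120, 11), (2491296775765, 20), (21453982471562, 25), (59572679897, 38), (214913456420, 41)]),
    (1, [(1, 41), (12, 42)]), (1, [(13, 0), (1, 42)]),
    (401580616, [(1752781, 8), (30038247, 15), (114020286, 24), (465152503, 25), (541012893, 36), (105462891, 42)]),
    (1, [(1, 45)]), (1, [(1, 46)]), (1, [(1, 47)]),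
    (5206907982, [(379325760, 8), (394789224, 11), (3348763723, 30), (4822744693, 33), (999732025, 41), (18668427409, 42)]),
    (896131809550, [(284001972799, 5), (29706400002, 8), (859166026132, 11), (2619019932176, 25), (20105953019, 41), (572790182714, 50)]),
    (1, [(1, 50)]),
    (218098401411, [(15602068001, 8), (71858990442, 11), (365682528065, 30), (5682016224, 39), (23806766640, 41), (283761210596, 45)]),
    (5627659863, [(781953708, 5), (573742530, 16), (2079966451, 24), (15582608816, 25), (15523252101, 36), (78475553, 41)]),
    (649547136, [(406321447, 14), (355417751, 15), (1290070179, 24), (2906818138, 25), (9876410031, 36), (699661413, 42)]),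
    (81193392, [(324589195, 14), (109109723, 15), (301235127, 24), (523254802, 25), (2580352419, 36), (283437345, 42)])]

def certificatePos2 : Fin 54 → ℕ × List (ℕ × Fin 54) := ![

    (60812654150, [(4208850254, 5), (4197365766, 6), (14386267864, 14), (580241429, 20), (42883923, 38), (17109263812, 44)]),
    (364875924900, [(11866874502, 5), (4542838658, 6), (58389364282, 14), (529263877, 20), (87711199, 38), (16641988856, 44)]),
    (179498669766, [(580776409411, 4), (84235617518, 5), (89719779948, 6), (307804658, 9), (322267967374, 30), (1929766027, 38)]),
    (15225184531, [(48156386668, 4), (4613681162, 5), (18416027960, 6), (4606741230, 20), (7246002561, 30), (3507708996, 34)]),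
    (22480332002, [(128629397549, 4), (19993406903, 5), (34579959354, 6), (43010046631, 30), (10082628618, 34), (15045690871, 50)]),
    (260161265138, [(1555314564744, 4), (216378589378, 5), (235574988874, 6), (66897450201, 20), (721429450632, 30), (8083914903, 38)]),
    (14036986981, [(27217309365, 5), (107622752670, 14), (977056115, 15), (3391610413, 21), (76287109015, 30), (11809746265, 44)]),
    (26386650878, [(895719785249, 4), (217147210130, 5), (250061575624, 10), (71368891973, 20), (86736425422, 30), (54162074298, 39)]),
    (46477508676, [(4257188366340, 4), (734390070696, 5), (1341305305410, 10), (304285859694, 20), (78447433865, 29), (432189550337, 30)]),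
    (260161265138, [(7260017745627, 4), (809780039744, 5), (1049901562400, 6), (156981660346, 20), (1782144114596, 30), (25621341287, 38)]),
    (70912702668, [(479477932865, 4), (66823704135, 5), (28177899443, 6), (1013027305, 16), (51293713185, 20), (41706338190, 34)]),
    (13193325439, [(440641312728, 4), (107094833050, 5), (126929913831, 10), (33329532870, 20), (55280785978, 30), (25885322433, 39)]),
    (30450369062, [(843880012519, 4), (23024580250, 5), (128767566152, 6), (26786775185, 20), (178133977196, 30), (52609820702, 34)]),
    (4401921231, [(291191887905, 4), (47801171631, 5), (50312680443, 10), (3161860346, 29), (70215250037, 30), (1613716671, 50)]),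
    (260161265138, [(1321969364284, 4), (433412527242, 5), (181549591068, 6), (104272585903, 20), (310161883572, 30), (4736846649, 38)]),
    (260161265138, [(6314702367501, 4), (977087327862, 5), (1875222063766, 6), (500033546975, 20), (236727155140, 30), (23820673188, 38)]),
    (46477508676, [(2779033505598, 4), (451815397116, 5), (870989398110, 10), (202362328968, 20), (53583266113, 29), (274880983993, 30)]),
    (434168225788, [(5409302421582, 5), (1419297289394, 6), (25178440834034, 14), (94130170195, 20), (13240141329708, 30), (44042246709, 38)]),
    (1017966293, [(115935200, 4), (2534757820, 5), (7222139352, 6), (8708298801, 14), (901938690, 34), (29946099512, 44)]),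
    (2477116917, [(1499006614, 4), (1974991833, 5), (320059054, 6), (12360074912, 14), (11813259944, 30), (830481210, 34)]),
    (26386650878, [(726799097767, 4), (174967689640, 5), (193268445916, 10), (62347506113, 20), (63373138778, 30), (48185220592, 39)]),
    (260161265138, [(4907130473573, 4), (551107891734, 5), (872524834546, 6), (40840467414, 20), (1533946533882, 30), (14979078459, 38)]),
    (978204718, [(41715260035, 4), (7552776735, 5), (6944487204, 10), (412634850, 29), (10024773245, 30), (206250345, 50)]),
    (76363494621, [(2162412113088, 4), (350662421562, 6), (187178681814, 14), (44049174142, 20), (2868003203, 38), (486764045309, 49)]),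
    (513311799, [(1688909942, 4), (29374915, 5), (165336304, 6), (133032044, 19), (684401860, 30), (81983627, 34)]),
    (111619008423, [(2125092196996, 4), (232891041024, 5), (738444169841, 10), (36282657322, 16), (785548474386, 30), (125888597081, 34)]),
    (62520202575, [(11109766100, 13), (5278551031823, 14), (50754122392, 15), (1385109689323, 19), (53937995467, 21), (2315643776875, 30)]),
    (260161265138, [(2087495386523, 4), (311090063362, 5), (276069645678, 6), (20629908284, 20), (261423920516, 30), (4185692177, 38)]),
    (90994048258, [(1208111921692, 4), (243343253868, 5), (107880661572, 6), (162804762812, 14), (32322657735, 20), (2659543371, 38)]),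
    (152726989242, [(3325451908644, 4), (519975248280, 6), (563258584476, 14), (77087644693, 20), (4613786867, 38), (840157663382, 49)]),
    (46477508676, [(145939631190, 4), (35027966868, 5), (65844325062, 10), (12174883140, 20), (2838021631, 29), (34210753099, 30)]),
    (23238754338, [(240582292356, 4), (36736553526, 5), (79742865660, 10), (18620376486, 20), (4728047051, 29), (12891713729, 30)]),
    (20840067525, [(1957877750, 13), (608622457806, 14), (6077161274, 15), (158960281806, 19), (3270667224, 21), (264588121325, 30)]),
    (434168225788, [(4557633863438, 5), (919731643858, 6), (20853040884826, 14), (99550082395, 20), (10720137488856, 30), (36479570557, 38)]),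
    (386710942086, [(6011733881431, 4), (305321024873, 5), (1182002701601, 6), (19946255543, 8), (168510259971, 9), (2099753584863, 30)]),
    (181988096516, [(6913265812730, 4), (1305849647098, 5), (615693491750, 6), (916814551674, 14), (187987558043, 20), (16496185211, 38)]),
    (15492502892, [(45189415996, 4), (9717360568, 5), (12900862562, 10), (3017993466, 20), (797045837, 29), (9129132097, 30)]),
    (3873125723, [(24699002565, 4), (4162166438, 5), (7552051533, 10), (1828951576, 20), (469141129, 29), (2117356896, 30)]),
    (152726989242, [(18490552963197, 4), (3068629942704, 6), (319504352070, 14), (375775649818, 20), (25096273553, 38), (3820912732502, 49)]),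
    (1017966293, [(464337854, 4), (1274352849, 5), (524422809, 6), (5290829851, 14), (121508574, 34), (3262259505, 44)]),
    (16116640086, [(34119770262, 4), (2745132276, 10), (7494120228, 19), (1009977030, 20), (557664301, 29), (4449721495, 30)]),
    (62520202575, [(23933268250, 13), (15577732822651, 14), (136548630254, 15), (4026886138676, 19), (200856918404, 21), (6902959421750, 30)]),
    (5293008787, [(12747435451, 5), (2834968644, 10), (68685931614, 14), (429617710, 20), (33790722971, 30), (1898819389, 34)]),
    (3769521554, [(17125515833, 4), (3026671462, 5), (2551443954, 10), (154538637, 20), (3126466938, 30), (622112662, 39)]),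
    (30450369062, [(105946183937, 4), (19067452352, 5), (38338627478, 6), (8644869467, 20), (27629591908, 30), (6258611552, 34)]),
    (1552155934, [(21474518901, 4), (4046817452, 5), (7485725212, 10), (1461615769, 20), (3476109330, 30), (1344574302, 39)]),
    (13747490455, [(457206403805, 4), (54685524987, 5), (134525368039, 10), (39055589552, 20), (11442766973, 34), (21187385512, 39)]),
    (62520202575, [(10670000125, 13), (5626869390601, 14), (56385356579, 15), (1468753529051, 19), (64752342554, 21), (2469307783025, 30)]),
    (64451823681, [(1130070165841, 4), (73194170663, 5), (187775526725, 6), (3114896972, 8), (30425316444, 9), (398162592126, 30)]),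
    (260161265138, [(912879181121, 4), (91165103564, 5), (168991400694, 6), (4146333817, 20), (543857438250, 30), (3883486820, 38)]),
    (26386650878, [(543833251729, 4), (129978757744, 5), (140960416772, 10), (43973953435, 20), (80871359524, 30), (36988432072, 39)]),
    (170194990789, [(2031363180397, 4), (170779622970, 6), (411783381630, 19), (24538161048, 29), (373864210563, 30), (1956647191, 41)]),
    (13193325439, [(312563579785, 4), (61093188986, 5), (38436465242, 10), (4727993194, 20), (35689732928, 30), (10389036577, 39)]),
    (90994048258, [(3782520840511, 4), (723968524740, 5), (320265606130, 6), (479020314190, 14), (112633021769, 20), (9334765328, 38)])]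

def certificateNeg2 : Fin 54 → ℕ × List (ℕ × Fin 54) := ![

    (365145618426, [(66157007717, 3), (4324663685, 6), (128659629, 9), (1029176734, 19), (326223872, 29), (852145087, 46)]),
    (253618078362, [(60699902096, 4), (6006480147, 5), (9739668389, 6), (1736164206, 12), (781161391, 16), (50885928060, 30)]),
    (130479028580, [(393920936257, 4), (43674285210, 5), (13002290390, 9), (61877521460, 10), (51668300183, 20), (2510659346, 25)]),
    (50852299113, [(156416872824, 4), (5321661480, 5), (202050862, 8), (7034963496, 15), (5208095554, 21), (51839482577, 30)]),
    (165164622684, [(1085436365967, 4), (1801990830, 13), (77424858984, 19), (85882385937, 20), (16868728955, 29), (68854162739, 30)]),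
    (13747490455, [(86516146610, 4), (17824359874, 5), (8785167463, 10), (9133502399, 20), (1243413996, 34), (2259046189, 39)]),
    (17607684924, [(110101918488, 4), (15089233890, 5), (27355646394, 10), (1063811951, 29), (66605004821, 30), (4337963382, 50)]),
    (50852299113, [(1063898930187, 4), (55202159952, 5), (496748930, 8), (38578700028, 15), (38837528825, 21), (725825639764, 30)]),
    (2556215912, [(81121054603, 4), (92482734479, 30), (43360143778, 44), (3489777649, 45), (35848767875, 49), (1672220006, 51)]),
    (15225184531, [(412134453223, 4), (53867377007, 5), (50621962760, 6), (58741951572, 20), (58346993633, 30), (29677885813, 34)]),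
    (32233280172, [(210734431764, 4), (37715982882, 10), (33194100168, 19), (9875516838, 20), (2596390265, 29), (87848486321, 30)]),
    (9985873907, [(204244438741, 4), (8517047598, 5), (8845305892, 15), (7639032221, 21), (134524953096, 30), (1801077109, 49)]),
    (22480332002, [(597624458685, 4), (11773824629, 5), (103589023414, 6), (136779800525, 30), (56702826172, 34), (117176133639, 50)]),
    (13268258362, [(1059449003420, 4), (6943575089, 5), (192525110055, 6), (34613273875, 16), (385679047852, 30), (77669410214, 34)]),
    (130033521670, [(661884987027, 4), (72816712020, 6), (49259833289, 20), (114363380530, 30), (7063888738, 34), (2263938634, 38)]),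
    (2060857761, [(26164878720, 4), (1256051966, 15), (17750983126, 30), (3170480604, 44), (4769439030, 49), (1127928811, 51)]),
    (4121715522, [(82536677382, 4), (1858518137, 15), (99840802732, 30), (45005852124, 44), (44019973461, 49), (484109221, 51)]),
    (201455344, [(2872668871, 3), (2043805278, 4), (75433897, 5), (2822732605, 30), (14411920, 34), (1035969872, 49)]),
    (111619008423, [(2752432667152, 4), (217035656712, 5), (669367742387, 10), (76914016750, 16), (1135090768929, 30), (152550102185, 34)]),
    (97647899761, [(509810492127, 4), (84090826003, 5), (67374543046, 6), (87585749884, 30), (1307135171, 38), (55218613086, 50)]),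
    (152556897339, [(2849118365286, 4), (191442206610, 5), (13877708486, 8), (18813030357, 15), (88791166094, 21), (1811659043728, 30)]),
    (15225184531, [(282960090822, 4), (33097845054, 5), (26137230631, 6), (44261949296, 20), (20223184996, 30), (22763986251, 34)]),
    (17775431944, [(829983643861, 4), (167849224884, 5), (63387985782, 6), (112330907047, 20), (21245336261, 29), (205786869269, 30)]),
    (34179911388, [(1161080375037, 4), (19358331378, 6), (343396258224, 19), (143823700227, 20), (29628047117, 29), (368489308937, 30)]),
    (315309613102, [(870053707461, 4), (206597262260, 5), (136338670316, 10), (149395853950, 20), (1747197494, 29), (3983358323, 38)]),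
    (962270190752, [(12450835463959, 4), (1308225825388, 5), (81428561878, 8), (81144165402, 13), (249382565995, 20), (5670313732440, 30)]),
    (6047069982, [(54408102389, 4), (38801772120, 5), (136765939372, 30), (128472085, 38), (123928623364, 44), (7983398552, 49)]),
    (121625308300, [(191796687814, 5), (291061431706, 6), (315617042474, 14), (108517667889, 20), (4101509143, 38), (1248499657492, 44)]),
    (21456316, [(349455251, 4), (6660058, 6), (96314388, 19), (44908489, 20), (9282885, 29), (98098909, 30)]),
    (17089955694, [(476913332067, 4), (12564099816, 6), (140760577338, 19), (55883559747, 20), (11823752648, 29), (173392712726, 30)]),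
    (2060857761, [(4172069379, 4), (108512500, 15), (2646516254, 30), (2392082175, 44), (1032765174, 49), (146506814, 51)]),
    (336259084, [(895614073, 4), (31481239, 5), (1395288461, 30), (1129720058, 44), (646480452, 49), (11593439, 50)]),
    (1007844997, [(3079047069, 4), (2441808866, 5), (7925336539, 30), (5309397, 38), (7355460680, 44), (480439864, 49)]),
    (100727672, [(1099038649, 3), (816296114, 4), (112018047, 5), (1220662051, 30), (15164520, 34), (280424720, 49)]),
    (260161265138, [(4496306344605, 4), (827786583160, 5), (435718258500, 6), (517185018688, 20), (599730145962, 30), (17583850493, 38)]),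
    (34179911388, [(1624348730931, 4), (23318786454, 6), (469445232624, 19), (208008138477, 20), (41845031087, 29), (433627628075, 30)]),
    (9985873907, [(14238245356, 4), (140886159, 5), (651971047, 15), (400270347, 21), (10153872158, 30), (1849062309, 49)]),
    (4121715522, [(8495260914, 4), (167972075, 15), (10711003036, 30), (4704874794, 44), (4327604907, 49), (90356215, 51)]),
    (17089955694, [(2399802617859, 4), (28492208736, 6), (697906270212, 19), (304073241681, 20), (61388769350, 29), (653600718608, 30)]),
    (130080632569, [(875177725082, 4), (186614492691, 5), (142531032685, 6), (79744306735, 20), (657963746461, 30), (4198962288, 38)]),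
    (119414325258, [(336952781762, 4), (10929719733, 5), (55710869423, 6), (9875395507, 16), (95018104506, 30), (20570158122, 34)]),
    (3023534991, [(81292096016, 4), (54995134746, 5), (203809025563, 30), (185567005, 38), (173813039005, 44), (13385440364, 49)]),
    (3099780078, [(23870920329, 3), (947671436, 4), (496147085, 5), (936007284, 6), (476340359, 25), (407032958, 34)]),
    (260161265138, [(1270899584489, 4), (253272354092, 5), (129039678078, 6), (168964693118, 20), (367697809274, 30), (6585343177, 38)]),
    (184746807711, [(693331254648, 4), (7601035598, 8), (4431149577, 13), (164359299, 15), (5338701890, 21), (174478340239, 30)]),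
    (1373905174, [(7791424626, 4), (363548887, 15), (6488503284, 30), (4502961896, 44), (3115869869, 49), (198379105, 51)]),
    (410700559, [(3838317126, 4), (448866455, 5), (32633744, 15), (5611474084, 30), (3050809117, 44), (1953072736, 49)]),
    (100727672, [(1707689525, 3), (1857939090, 4), (28421411, 5), (2338347087, 30), (5809712, 34), (891973752, 49)]),
    (130080632569, [(2412353796111, 4), (426846107333, 5), (292479017319, 6), (291638894992, 20), (293280452758, 30), (9829262556, 38)]),
    (5869030023, [(19386697900, 4), (2821717414, 5), (2664291741, 10), (1808654418, 20), (1391364649, 25), (1235830036, 34)]),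
    (677445168012, [(9972092918566, 4), (1076494275823, 5), (16478725111, 13), (4379652327264, 30), (19370760895, 38), (728936619133, 45)]),
    (13331573958, [(151641853773, 4), (32862863622, 5), (7451405922, 6), (22844851821, 20), (3853097567, 29), (14123902901, 30)]),
    (260161265138, [(6482874772731, 4), (1147412463038, 5), (800166405776, 6), (839489914782, 20), (2216932791504, 30), (35084815189, 38)]),
    (8544977847, [(434356181754, 4), (8922763653, 6), (123533553327, 19), (55008797637, 20), (11088964358, 29), (117947657666, 30)])]

def certificatePos3 : Fin 54 → ℕ × List (ℕ × Fin 54) := ![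

    (5809800955748, [(528845815738, 5), (1620602214238, 6), (4395767960, 8), (1739287401142, 14), (48287042011, 20), (6211193537, 38)]),
    (2754151003258, [(58069901870, 5), (385804772164, 6), (165588909832, 14), (7662221331, 18), (424858250, 38), (1012150675, 41)]),
    (16116640086, [(11716203849, 5), (38224333488, 6), (64877070654, 14), (1269409101, 18), (1805111222, 24), (253931744, 33)]),
    (434168225788, [(798513031754, 5), (1053202759342, 6), (1784747914926, 14), (46343557917, 20), (182855139920, 30), (4835969419, 38)]),
    (5083200189602, [(15411052401534, 5), (20071382357128, 6), (42939461645800, 14), (1238736713487, 20), (148693511269, 38), (35521648896, 41)]),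
    (1908587952, [(5772558466, 4), (3165132342, 5), (11318355611, 10), (4985381347, 14), (1913957161, 30), (540144941, 34)]),
    (217084112894, [(439037773736, 5), (1123449386176, 6), (1839212733260, 14), (18712942057, 20), (345644030874, 30), (6975026165, 38)]),
    (434168225788, [(6803074850018, 5), (11885692147730, 6), (16248890972750, 14), (605305728945, 20), (795535572924, 30), (53302570751, 38)]),
    (46477508676, [(2393185050090, 4), (1939982553156, 5), (4764834573078, 10), (117112117956, 20), (53083540367, 29), (428707087583, 30)]),
    (954293976, [(2274330346, 4), (7253300910, 5), (24669277895, 10), (14857722823, 14), (3999378037, 30), (740008025, 34)]),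
    (831363856290, [(4421243262365, 4), (1431669841626, 5), (28970977162, 8), (5947304965828, 10), (146587311176, 25), (30974386203, 38)]),
    (434168225788, [(6774864283166, 5), (11677314465054, 6), (16091189041390, 14), (620431168903, 20), (541883029808, 30), (52051912349, 38)]),
    (1908587952, [(3793285610, 4), (14306712846, 5), (50178513583, 10), (31181063879, 14), (8573692853, 30), (1591730617, 34)]),
    (663707478866, [(14141988444756, 5), (40493589985684, 10), (22776512633644, 14), (851882709159, 20), (176393463006, 25), (80876277811, 38)]),
    (10166400379204, [(22405777824608, 5), (33605317771594, 6), (71502184558330, 14), (1357510911257, 20), (273583929203, 38), (131232498038, 41)]),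
    (108542056447, [(1211080013532, 5), (2031196450245, 6), (2786291138052, 14), (94985169087, 20), (128448838437, 30), (7948631756, 38)]),
    (46477508676, [(1568662994406, 4), (1255483132344, 5), (3137223766458, 10), (59266495116, 20), (32873866339, 29), (390388670851, 30)]),
    (434168225788, [(7088996146486, 5), (17432497375322, 6), (18378423149142, 14), (407262693911, 20), (2993291386436, 30), (56981476945, 38)]),
    (50566557528, [(331394660706, 5), (1046704940415, 10), (848014021191, 14), (217031971985, 30), (28206765445, 34), (723210886, 38)]),
    (2477116917, [(1696749238, 4), (2589001992, 5), (9973367494, 6), (14027149379, 14), (2419379456, 30), (712045764, 34)]),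
    (217084112894, [(2750909678698, 5), (4825662484612, 6), (6790879857096, 14), (195782948539, 20), (710173446252, 30), (21610516561, 38)]),
    (25283278764, [(162200262066, 5), (422237014569, 10), (324989063385, 14), (65703574135, 30), (2693970959, 34), (484864118, 38)]),
    (1184452926, [(7976322491, 5), (33440961320, 6), (11691639175, 10), (37512332577, 14), (10655206540, 24), (1146864113, 42)]),
    (394817642, [(585505187, 5), (9965764818, 6), (669814083, 10), (6997400511, 14), (2899261038, 24), (291405203, 42)]),
    (197408821, [(86026006, 5), (430211714, 6), (104782253, 10), (640311624, 14), (130883553, 24), (4279150, 42)]),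
    (217084112894, [(1846882984588, 5), (3242844810860, 6), (4927263486864, 14), (137502710351, 20), (344145617768, 30), (14886453163, 38)]),
    (434168225788, [(10051326938582, 5), (23825802887610, 6), (25736495347998, 14), (514258941931, 20), (4454275040396, 30), (76767045557, 38)]),
    (394817642, [(486053423, 5), (1530976674, 6), (1241421657, 10), (1975247991, 14), (589925976, 24), (70424135, 42)]),
    (197408821, [(211396114, 5), (2127880051, 6), (438859531, 10), (1713565257, 14), (702046527, 24), (78095854, 42)]),
    (10744426724, [(7377973152, 5), (237302396726, 6), (155963665560, 14), (399206910, 18), (65803367205, 24), (1972855117, 33)]),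
    (161027258489, [(300843744600, 5), (449397916135, 6), (620446559655, 14), (122677620827, 30), (1759491636, 38), (17727419973, 50)]),
    (434168225788, [(1965248397742, 5), (4030353830018, 6), (4507702771542, 14), (74830597313, 20), (843725524364, 30), (11423627107, 38)]),
    (39469838708, [(313408621378, 5), (755938623142, 6), (805696719102, 14), (12820495337, 20), (158641938840, 30), (2308669591, 38)]),
    (108542056447, [(1414716313962, 5), (3603536175578, 6), (3769655493291, 14), (89483695662, 20), (586237702693, 30), (12220920012, 38)]),
    (5508302006516, [(23011531117854, 5), (61170420335038, 6), (93632037377570, 14), (667479281811, 18), (191090087326, 38), (153747613611, 41)]),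
    (394817642, [(1076194033, 5), (12899132282, 6), (1751844369, 10), (10042176657, 14), (3951760514, 24), (399537289, 42)]),
    (259155333122, [(506688094154, 4), (329234265586, 5), (2822122833, 8), (837193375683, 10), (17527673511, 20), (2451598515, 38)]),
    (434168225788, [(1181975192914, 5), (2413501556690, 6), (2852411181322, 14), (63123438217, 20), (390161676004, 30), (7738578147, 38)]),
    (197408821, [(1547900391, 5), (19251435343, 6), (2159696269, 10), (14652599214, 14), (5782214118, 24), (583216317, 42)]),
    (32233280172, [(4948842858, 5), (189598216230, 6), (100228006356, 14), (1475585616, 18), (40488583781, 24), (1751503817, 33)]),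
    (16855519176, [(11785031646, 5), (30802778901, 10), (22183375101, 14), (5596509907, 30), (117862727, 34), (49022882, 38)]),
    (39469838708, [(2679791986682, 5), (6386090718150, 6), (6906542270886, 14), (143514220651, 20), (1146487312040, 30), (20739562985, 38)]),
    (434168225788, [(1424999424638, 5), (4004386237442, 6), (3934610788854, 14), (124636096747, 20), (423389781564, 30), (13931576621, 38)]),
    (331853739433, [(457053244812, 5), (1375050961699, 10), (742631222290, 14), (16793357160, 20), (26671993171, 25), (3072634233, 38)]),
    (10166400379204, [(21187187925620, 5), (24898868099414, 6), (48590216876710, 14), (1574919945959, 20), (148685946065, 38), (35560404570, 41)]),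
    (23238754338, [(197458908873, 4), (158980338630, 5), (357687333342, 10), (10028142063, 20), (3999661639, 29), (22295833327, 30)]),
    (108542056447, [(1475374866274, 5), (3204535568571, 6), (3647780751924, 14), (53649241609, 20), (697955072968, 30), (9617584754, 38)]),
    (434168225788, [(10690571251574, 5), (25400657263302, 6), (27542869743614, 14), (537087727849, 20), (4882360288636, 30), (82889406739, 38)]),
    (60434202541, [(199965092669, 5), (768139607920, 6), (15454449269, 12), (1152916488723, 14), (14090130830, 18), (7848268984, 33)]),
    (1908587952, [(2611329622, 4), (1976373138, 5), (6386222009, 10), (3450896113, 14), (537882115, 30), (211319711, 34)]),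
    (434168225788, [(4106760586666, 5), (7148840383714, 6), (10609318730770, 14), (255917898441, 20), (1205383579960, 30), (31895454775, 38)]),
    (197408821, [(429763962, 5), (1285160322, 6), (566979800, 10), (1783031189, 14), (387965043, 24), (36907716, 42)]),
    (592226463, [(1701863545, 5), (9317671540, 6), (3067088153, 10), (9597869649, 14), (3210321506, 24), (353172208, 42)]),
    (592226463, [(1473115463, 5), (22785172880, 6), (961170532, 10), (17474039094, 14), (6766027252, 24), (654382919, 42)])]

def certificateNeg3 : Fin 54 → ℕ × List (ℕ × Fin 54) := ![

    (364875924900, [(11866874502, 5), (4542838658, 6), (58389364282, 14), (529263877, 20), (87711199, 38), (16641988856, 44)]),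
    (217084112894, [(22168601410, 5), (30234814416, 6), (93511983300, 14), (1204542035, 20), (11382549652, 30), (187071877, 38)]),
    (108542056447, [(130119790784, 5), (257122277909, 6), (443728160254, 14), (11648781311, 20), (105842455747, 30), (1359690317, 38)]),
    (29933211886, [(68359731953, 4), (68289270, 9), (99912390175, 10), (920704177, 22), (5526142410, 24), (4263547356, 25)]),
    (15492502892, [(69156821960, 4), (18209093692, 5), (105143239130, 10), (2506053254, 20), (1048495727, 29), (3851883103, 30)]),
    (671570451164, [(1369777930978, 5), (3203396419934, 6), (4954110870582, 14), (160427095099, 20), (182902811264, 25), (17997324001, 38)]),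
    (5809800955748, [(14737964972414, 5), (28288223766662, 6), (253923029748, 8), (52868031158114, 14), (424481586823, 20), (74228060869, 38)]),
    (1908587952, [(3199833922, 4), (6749292054, 5), (33165909491, 10), (50726288107, 14), (13995800353, 30), (1762393205, 34)]),
    (31824627008, [(205922274374, 5), (708583128622, 6), (11698769300, 9), (2632838137390, 14), (67375318791, 20), (5586769493, 38)]),
    (138560642715, [(4114950279730, 4), (1307970433698, 5), (36093608951, 8), (4168190143814, 10), (113289626038, 25), (19165084944, 38)]),
    (238573494, [(40443140, 4), (707103798, 5), (1395828853, 10), (1571691083, 14), (571077599, 30), (15757507, 34)]),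
    (822448880162, [(18701400976243, 4), (18529674471926, 10), (3168984844121, 24), (68923777507, 33), (31666807629, 38), (27639432486, 41)]),
    (434168225788, [(5470314429798, 5), (8640957343158, 6), (19292167096002, 14), (436043938591, 20), (3523434755964, 30), (50632045041, 38)]),
    (1295776665610, [(108185077938718, 4), (32340251868766, 5), (356147706717, 8), (97641707361513, 10), (3701953576172, 20), (455451132698, 38)]),
    (22800405987, [(27372583065, 5), (94814091027, 6), (141639601809, 14), (30066528623, 30), (1258696618, 34), (94502722, 38)]),
    (48130725516, [(727475055119, 4), (695810995032, 10), (34407774729, 14), (90520992949, 24), (33274286603, 42), (5649308831, 53)]),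
    (372443790476, [(1747699146672, 5), (5253273005752, 6), (20425586610674, 14), (118506279594, 16), (161759545473, 20), (53997256599, 38)]),
    (5083200189602, [(24566349066429, 5), (25549967397466, 6), (190902982520924, 14), (1544805046357, 20), (399298162929, 38), (249289345097, 41)]),
    (434168225788, [(4544534149686, 5), (7437889987450, 6), (15632335836362, 14), (307261134509, 20), (3125491274936, 30), (38120221383, 38)]),
    (2541600094801, [(4824027023096, 5), (9196782616688, 6), (17389802902047, 14), (222383458693, 20), (47326814877, 38), (55315512654, 41)]),
    (108542056447, [(366053085004, 5), (1312589393899, 6), (3098758625349, 14), (71393874214, 20), (24108759618, 30), (6781035178, 38)]),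
    (259155333122, [(5287492549821, 4), (1663746359166, 5), (34777143321, 8), (5311579576569, 10), (155405108835, 20), (24960518642, 38)]),
    (315309613102, [(16910693457181, 4), (5270847630308, 5), (15450602701774, 10), (842723162521, 20), (64302157108, 29), (57859518146, 38)]),
    (3638413152, [(39957441750, 6), (245679689406, 14), (97598918010, 19), (3957705942, 20), (2471338933, 29), (23749187893, 30)]),
    (217084112894, [(297689242206, 5), (477251627650, 6), (949711868604, 14), (9211363365, 20), (332673228158, 30), (2528938455, 38)]),
    (48683877273, [(553117451306, 4), (282920298, 5), (13769479115, 9), (673678723584, 10), (65518583605, 24), (30444677224, 25)]),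
    (5083200189602, [(32183470159565, 5), (40878652664432, 6), (265865398920510, 14), (1590261914372, 20), (581373955882, 38), (418595724251, 41)]),
    (2477116917, [(124499359, 4), (7077720915, 5), (14358664888, 6), (33703178276, 14), (11055578558, 30), (1231775730, 34)]),
    (2477116917, [(902089316, 4), (15095522808, 5), (27685526549, 6), (68651144446, 14), (19440683191, 30), (2169608292, 34)]),
    (2533378443, [(32899326483, 5), (45339204495, 6), (126323207391, 14), (32487581708, 30), (620090326, 34), (184374673, 38)]),
    (16043575172, [(30742428361, 4), (41079278256, 10), (15817119995, 14), (4814181735, 24), (1817573145, 42), (315667761, 53)]),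
    (450053070530, [(29570598465, 5), (1127500894125, 6), (97055864830, 9), (4463287232772, 14), (19296658677, 16), (35089033540, 20)]),
    (10166400379204, [(23300066712386, 5), (27114356355706, 6), (188169949572994, 14), (319252072639, 20), (424845621121, 38), (390554398356, 41)]),
    (10166400379204, [(43917853639048, 5), (39247228556118, 6), (311864956232146, 14), (2889761499705, 20), (608875613003, 38), (353728065482, 41)]),
    (259155333122, [(4329526285589, 4), (1401329796864, 5), (46976349031, 8), (4811044970529, 10), (19669360819, 20), (17669180876, 38)]),
    (68401217961, [(1356065980095, 5), (2164294664658, 6), (5602080932589, 14), (1560261638303, 30), (93990093304, 34), (4851096985, 38)]),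
    (434168225788, [(111384884134, 5), (403226890390, 6), (1076597209970, 14), (20143166169, 20), (70173136400, 30), (2532836835, 38)]),
    (1862218952380, [(940494421620, 5), (2696689285120, 6), (10616934986938, 14), (41128346738, 16), (140011055635, 20), (27315643065, 38)]),
    (68401217961, [(4080952386060, 5), (6351151829283, 6), (16574474367069, 14), (4558288753078, 30), (216466688438, 34), (17999559740, 38)]),
    (108542056447, [(393968480827, 5), (480200780408, 6), (1503840891771, 14), (1562095103, 20), (343505033951, 30), (2576012104, 38)]),
    (55424257086, [(148210574671, 4), (43939056720, 5), (1588036565, 8), (150159554033, 10), (307966870, 25), (617130699, 38)]),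
    (10166400379204, [(190229808047714, 5), (234591461808218, 6), (1548637883791482, 14), (11702600167877, 20), (3373068342391, 38), (2221565547404, 41)]),
    (434168225788, [(543487041182, 5), (206585185258, 6), (3406005800326, 14), (66712970743, 20), (5227949796, 30), (5946817369, 38)]),
    (37022190446, [(213580869518, 4), (65401251422, 5), (491693395, 8), (194093892929, 10), (8169026449, 20), (882891765, 38)]),
    (87077859882, [(220763149985, 4), (843985164, 5), (328591991176, 10), (352299260, 16), (8515417131, 20), (15384180058, 34)]),
    (223359034312, [(1074070019679, 6), (39413562790, 9), (2830017451, 13), (2971356822332, 14), (80725478790, 20), (46568594600, 34)]),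
    (1081016113845, [(1422310128470, 5), (7884850916195, 6), (516181500890, 9), (32793246181052, 14), (236106028592, 16), (18341503435, 38)]),
    (5083200189602, [(36693726254227, 5), (48005684056096, 6), (290469696285136, 14), (1633460028730, 20), (626733542078, 38), (470071677247, 41)]),
    (434168225788, [(3278848006578, 5), (5936696716650, 6), (11686459603974, 14), (224785268231, 20), (2304273734740, 30), (28349337365, 38)]),
    (434168225788, [(566398900766, 5), (1133254812490, 6), (1928013014538, 14), (99213810441, 20), (163087054300, 30), (7245302915, 38)]),
    (364663803122, [(1346733348396, 5), (4126250446046, 10), (6251642172026, 14), (28036453483, 20), (1633053003902, 30), (12364507385, 38)]),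
    (434168225788, [(2040832538102, 5), (3604510436822, 6), (7997868637226, 14), (26023488445, 20), (2545156406512, 30), (19771687555, 38)]),
    (315309613102, [(9480351756687, 4), (2997098544240, 5), (8396182749272, 10), (434107588870, 20), (75458399028, 29), (21357149325, 38)]),
    (68401217961, [(1470480102852, 5), (2317088310606, 6), (5981289497556, 14), (1657173523699, 30), (90924089567, 34), (5575613588, 38)])]

def certificatePos4 : Fin 54 → ℕ × List (ℕ × Fin 54) := ![

    (260161265138, [(10828720302, 4), (78463949274, 5), (63887832996, 6), (1723201823, 20), (10213474284, 30), (211287899, 38)]),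
    (33361217340, [(209866141, 4), (3932860562, 5), (1277310890, 6), (1165922842, 19), (1030570224, 30), (6427289, 38)]),
    (176363073342, [(452422633740, 5), (564458205396, 6), (12693414126, 20), (7372535545, 29), (18928921903, 30), (3049356210, 46)]),
    (6105718788516, [(18827647955079, 5), (19288616368748, 6), (596627011508, 11), (6101200323638, 14), (362091194222, 22), (19235657151, 41)]),
    (42714231430, [(59540139096, 4), (215985450300, 5), (281254402600, 6), (6329915969, 20), (8196246818, 25), (1599728555, 38)]),
    (15492502892, [(18209093692, 4), (69156821960, 5), (105143239130, 6), (2506053254, 18), (3851883103, 24), (1048495727, 33)]),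
    (46048987049, [(89470821886, 4), (88734794099, 5), (242296988594, 10), (317983679551, 19), (6761506681, 20), (1024262031, 38)]),
    (22992900540, [(146995269627, 4), (701755978880, 5), (717518346310, 6), (9274306533, 20), (13459099430, 22), (37604873356, 25)]),
    (184195948196, [(1777708976384, 4), (13882512876218, 5), (11919862899586, 10), (7240853854826, 19), (810516551275, 20), (64812979205, 38)]),
    (39191794076, [(890002409296, 5), (879682648376, 6), (5291522172, 20), (9849737185, 29), (120209984309, 30), (7808380290, 46)]),
    (137860921575, [(239797194229, 4), (768604119983, 5), (1006021948385, 6), (3216950917, 22), (165592487671, 30), (2030777801, 38)]),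
    (761788077860, [(7472728400041, 4), (23761755997571, 5), (22530869128220, 6), (155239697400, 13), (56644813019, 38), (102936344049, 41)]),
    (352726146684, [(8134194344412, 5), (8121208377444, 6), (22704002124, 20), (85530454187, 29), (1349254043819, 30), (64375645782, 46)]),
    (3931170295, [(2388893304, 4), (128107708985, 5), (133856172380, 6), (7089627212, 11), (146557408913, 19), (10500720772, 39)]),
    (260161265138, [(288950190853, 4), (1088693897810, 5), (1430290364986, 6), (32153681948, 20), (167200979388, 30), (6826904005, 38)]),
    (259155333122, [(1663746359166, 4), (5287492549821, 5), (5311579576569, 6), (34777143321, 13), (155405108835, 18), (24960518642, 41)]),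
    (315309613102, [(5270847630308, 4), (16910693457181, 5), (15450602701774, 6), (842723162521, 18), (64302157108, 33), (57859518146, 41)]),
    (4570728467160, [(55926982710793, 4), (199115458419583, 5), (156404978919540, 6), (774509286780, 13), (344831222867, 38), (672137691677, 41)]),
    (39191794076, [(731835233884, 5), (780448321472, 6), (3740362664, 20), (8314341533, 29), (155976719917, 30), (2617367250, 46)]),
    (380852804547, [(1633711171305, 5), (1996679154394, 6), (32747857885, 11), (492911170765, 14), (8754280435, 22), (1779643215, 38)]),
    (217084112894, [(5998126006616, 5), (4959120776164, 6), (1830217454072, 14), (244933642585, 20), (207523830430, 30), (27076509483, 38)]),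
    (21737916919, [(327173152457, 5), (318479187640, 6), (11790945030, 19), (33619431953, 30), (15276229227, 39), (5649308831, 46)]),
    (786234059, [(654285418, 4), (14596527150, 5), (16458569822, 6), (929821874, 11), (21506895616, 19), (1472813729, 39)]),
    (11793510885, [(30302168379, 4), (92111931250, 5), (96550885845, 6), (7462122592, 11), (310185183378, 19), (12658454732, 39)]),
    (30431597839, [(48572355553, 5), (74546457474, 6), (1768413662, 11), (44912848411, 19), (3583343566, 39), (535125441, 46)]),
    (184195948196, [(494367524016, 4), (2237587047730, 5), (2769466686570, 10), (2194865453270, 19), (162602118169, 20), (15508465843, 38)]),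
    (217084112894, [(13768905164796, 5), (9522460310964, 6), (3502231059438, 14), (473099395831, 20), (502269844086, 30), (42808751587, 38)]),
    (4717404354, [(505773231, 4), (12758059744, 5), (15697025901, 6), (999374404, 11), (27462111591, 19), (1513842617, 39)]),
    (23587021770, [(28108572783, 4), (81567180340, 5), (99467621235, 6), (7816991434, 11), (309774589611, 19), (13817080169, 39)]),
    (7862340590, [(20090973393, 4), (49579203900, 5), (49817101545, 6), (3804829454, 11), (171037724831, 19), (6691721509, 39)]),
    (2035239596172, [(7019327267943, 5), (5838836379440, 6), (155737239764, 11), (2560167643346, 14), (121638944750, 22), (13099091391, 41)]),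
    (6105718788516, [(65062729230771, 5), (49496185817584, 6), (1986950607208, 11), (15142279102006, 14), (738669144238, 22), (10504822275, 41)]),
    (108542056447, [(2390924938590, 5), (1632237454492, 6), (608910680731, 14), (85566609575, 20), (44994441601, 30), (7225619167, 38)]),
    (184090620200, [(1820899279435, 4), (6683118838785, 5), (5165853355296, 6), (20617604096, 8), (22095194865, 38), (12951692339, 41)]),
    (260161265138, [(105173701132, 4), (3200725130136, 5), (3473699711484, 6), (97007322683, 20), (275278818920, 30), (10483317583, 38)]),
    (11793510885, [(37255936449, 4), (130957073990, 5), (150055933725, 6), (10783664402, 11), (421100764848, 19), (18353213062, 39)]),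
    (304715231144, [(242336839265, 4), (817936495599, 5), (824509987392, 6), (8613384800, 13), (153983435, 38), (3386295141, 41)]),
    (37022190446, [(65401251422, 4), (213580869518, 5), (194093892929, 6), (491693395, 13), (8169026449, 18), (882891765, 41)]),
    (11793510885, [(109791387663, 4), (394019718220, 5), (434357508420, 6), (31399190689, 11), (1218024200916, 19), (53429142674, 39)]),
    (2358702177, [(1797350838, 4), (3998886286, 5), (2397762396, 6), (272497378, 11), (13747797699, 19), (455937383, 39)]),
    (907406136, [(1527091884, 5), (1418752764, 6), (6795121, 29), (236389009, 30), (44583204, 39), (18032790, 46)]),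
    (108542056447, [(20279611734036, 5), (14098790167779, 6), (5098425187257, 14), (683276724403, 20), (855356064084, 30), (62685831223, 38)]),
    (716578724540, [(1378308489907, 4), (7215088065412, 5), (5251453627238, 6), (1699778938, 8), (249184154335, 20), (21497656148, 38)]),
    (23587021770, [(2060847393, 4), (47015352160, 5), (51531791265, 6), (2827125724, 11), (66313799901, 19), (4364677769, 39)]),
    (671570451164, [(2271081601938, 5), (2284666701066, 6), (678958541114, 14), (106810892193, 20), (47382564596, 25), (15832550831, 38)]),
    (7746251446, [(31152358736, 4), (95561691036, 5), (90687947764, 6), (5294763790, 18), (1459478745, 24), (2160535035, 33)]),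
    (683133238228, [(23604755997582, 5), (17236929420198, 6), (578975005652, 11), (5857040440742, 14), (185178520747, 20), (74959368629, 38)]),
    (434168225788, [(29352598236550, 5), (20406299859350, 6), (7573789623846, 14), (980262916081, 20), (1215597007828, 30), (90911521639, 38)]),
    (793159044638, [(10708996822834, 5), (12214085362980, 6), (180019374139, 20), (39222434608, 22), (2068191442954, 30), (19504595027, 38)]),
    (315309613102, [(87222035894, 4), (826219076368, 5), (1166393486656, 6), (31219452717, 18), (2116033610, 33), (2881602921, 41)]),
    (92097974098, [(290874698571, 4), (1319698166236, 5), (1518458669220, 10), (1071210836874, 19), (87574861436, 20), (8469987331, 38)]),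
    (30431597839, [(181644973232, 5), (204871508761, 6), (6789428380, 11), (144706443654, 19), (14779196462, 39), (2095256085, 46)]),
    (23587021770, [(27470766087, 4), (181013838940, 5), (227763959295, 6), (14288873896, 11), (432663935829, 19), (24288764681, 39)]),
    (11793510885, [(45241086687, 4), (146468659495, 5), (173450656440, 6), (11587048126, 11), (452380449804, 19), (20232306161, 39)])]

def certificateNeg4 : Fin 54 → ℕ × List (ℕ × Fin 54) := ![

    (2754151003258, [(58069901870, 5), (385804772164, 6), (165588909832, 14), (7662221331, 18), (424858250, 38), (1012150675, 41)]),
    (217084112894, [(42357569796, 5), (70890594444, 6), (22445312112, 14), (2591991643, 20), (159466722, 30), (223357345, 38)]),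
    (108542056447, [(331847806870, 5), (334137269324, 6), (195790020038, 14), (5306068395, 20), (87416098223, 30), (1161390690, 38)]),
    (293321028, [(159953764, 4), (628125224, 5), (1021254437, 6), (46168825, 19), (213204569, 30), (6820033, 34)]),
    (2149736173620, [(3441994724873, 4), (11340635536768, 5), (13858458668782, 6), (93302798422, 8), (1132335975, 20), (14226732582, 38)]),
    (260161265138, [(475455792446, 4), (1448652768242, 5), (1615863844448, 6), (67172444025, 20), (146746555760, 30), (6432679357, 38)]),
    (3363023500278, [(4763550608942, 4), (18716189438009, 5), (24430618733078, 6), (338092316900, 11), (278169712312, 22), (81125813171, 41)]),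
    (260161265138, [(1287788156104, 4), (3981589585210, 5), (7715311993646, 6), (132179604629, 20), (446601632140, 30), (7611998489, 38)]),
    (15317880175, [(184945685684, 4), (392960641793, 5), (1103673934385, 6), (1059782807, 22), (182917025291, 30), (967486546, 38)]),
    (217084112894, [(5795764067936, 5), (7151697168676, 6), (3471224799280, 14), (175122204647, 20), (1142997331414, 30), (25581559015, 38)]),
    (315309613102, [(599849878156, 4), (1650128546254, 5), (2191724640408, 6), (82053203909, 18), (32236284382, 33), (4243606243, 41)]),
    (5372213362, [(27610523983, 4), (116629601510, 10), (149408079752, 19), (3813073939, 20), (814615336, 29), (1214906600, 30)]),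
    (217084112894, [(5886328532186, 5), (7213848278702, 6), (3506269240752, 14), (204484229289, 20), (984263836256, 30), (26587262341, 38)]),
    (434168225788, [(29603133541378, 5), (39349792708002, 6), (20172973304694, 14), (1159604959685, 20), (2276236193428, 30), (126871770011, 38)]),
    (683133238228, [(3170970023450, 5), (3393968155950, 6), (101139881244, 11), (916680655250, 14), (10553120965, 20), (3922174775, 38)]),
    (32233280172, [(110537172408, 4), (492934453314, 10), (588249252252, 19), (3979896246, 20), (2239457837, 29), (84394968857, 30)]),
    (2053247196, [(14287060804, 4), (30589219340, 5), (95825195291, 6), (61848679, 19), (18151667159, 30), (2063322811, 34)]),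
    (130080632569, [(565942298119, 4), (1026462128583, 5), (3970068975897, 6), (76089272430, 20), (216748027397, 30), (8178328220, 38)]),
    (1463607870, [(4839160002, 4), (34676362856, 5), (44940391004, 10), (4080984502, 19), (493095003, 29), (16195325531, 30)]),
    (260161265138, [(296681303199, 4), (1164219195172, 5), (1361054384572, 6), (59367370807, 20), (147938877930, 30), (5489437918, 38)]),
    (260161265138, [(917266936684, 4), (3478526820100, 5), (6350521839900, 6), (107396693045, 20), (591031981738, 30), (7151524827, 38)]),
    (217084112894, [(4003701124132, 5), (4945362119630, 6), (2555397335068, 14), (83083248939, 20), (929924283502, 30), (15953298233, 38)]),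
    (2927215740, [(26015668782, 4), (133523948396, 5), (198251061674, 10), (21306830272, 19), (1762945603, 29), (55723654371, 30)]),
    (721791120889, [(21070886806940, 5), (32919856123319, 6), (886761010762, 11), (14163734788770, 14), (424613561624, 18), (61094222105, 38)]),
    (217084112894, [(649721827824, 5), (681886680320, 6), (462970132628, 14), (21131236653, 20), (83476058696, 30), (2797144165, 38)]),
    (61282254059, [(172600789326, 4), (566012477536, 5), (980997946207, 6), (4821986012, 22), (98529700477, 30), (23309804934, 50)]),
    (394817642, [(1076194033, 4), (1751844369, 6), (12899132282, 10), (10042176657, 19), (3951760514, 30), (399537289, 39)]),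
    (170783309557, [(1308188064863, 5), (1731239215660, 6), (4615299530, 11), (954432665545, 14), (55214638898, 20), (5699825022, 38)]),
    (3052859394258, [(43682450553663, 5), (66837509770046, 6), (1372600253246, 11), (29697438989384, 14), (648610000718, 22), (39799057329, 41)]),
    (721791120889, [(16921443818591, 5), (27378082748944, 6), (746997121949, 11), (11221907739385, 14), (473666437530, 18), (40331020399, 38)]),
    (342207866, [(172218372, 4), (421211632, 5), (1137872799, 6), (281924945, 19), (209592375, 30), (8560497, 34)]),
    (13161841, [(16043477, 4), (26020331, 5), (108426584, 6), (8397316, 19), (19818984, 30), (2408186, 34)]),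
    (197408821, [(211396114, 4), (438859531, 6), (2127880051, 10), (1713565257, 19), (702046527, 30), (78095854, 39)]),
    (260161265138, [(927626722426, 4), (1658280897048, 5), (6432536374760, 6), (170340131085, 20), (48861565944, 30), (14679658967, 38)]),
    (161027258489, [(2562798965080, 5), (3050532326215, 6), (1310568978767, 14), (492459876323, 30), (10335849984, 38), (108232197161, 50)]),
    (721791120889, [(30116386359504, 5), (44939457936641, 6), (1218695886760, 11), (19992336158950, 14), (397322043940, 18), (99436880513, 38)]),
    (80478650486, [(32458758247, 4), (81436558546, 5), (173625143480, 6), (1748486337, 20), (601121136, 22), (17842442488, 30)]),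
    (91907281050, [(70873323881, 4), (155573111812, 5), (447172701190, 6), (382686188, 22), (78382902494, 30), (437821189, 38)]),
    (721791120889, [(89065661321796, 5), (132789550430974, 6), (3604865056229, 11), (58455976898594, 14), (988716612386, 18), (309645600139, 38)]),
    (721791120889, [(4240561926230, 5), (7636633798179, 6), (202352904804, 11), (2862257955212, 14), (156751699672, 18), (8970262671, 38)]),
    (434168225788, [(1022678633494, 5), (1277109145462, 6), (579128914442, 14), (30255155883, 20), (180728768384, 30), (4052020893, 38)]),
    (260161265138, [(4599002705578, 4), (8888365875150, 5), (32362755775660, 6), (489689352603, 20), (2757614550040, 30), (62245186139, 38)]),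
    (87077859882, [(80078417712, 4), (73311275071, 5), (576561704216, 6), (4414600125, 18), (3852943258, 22), (21563701250, 25)]),
    (2927215740, [(2671103682, 4), (14116262176, 5), (21073863634, 10), (2311983812, 19), (195039773, 29), (6060571581, 30)]),
    (195295799522, [(141804664006, 4), (531926862181, 5), (744454081862, 6), (87483257361, 30), (101478065, 38), (8490703873, 50)]),
    (342207866, [(774427776, 4), (1194509496, 5), (3875784955, 6), (599482561, 19), (651249117, 30), (66990363, 34)]),
    (260161265138, [(917865415651, 4), (2134424562154, 5), (6515304469264, 6), (5713803962, 20), (1256674733848, 30), (10016808335, 38)]),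
    (260161265138, [(1651032771165, 4), (3548945175130, 5), (12080815906580, 6), (190847078596, 20), (1071500218564, 30), (23534436121, 38)]),
    (217084112894, [(3863370508870, 5), (4370886510964, 6), (2059223569704, 14), (145795924137, 20), (472268493638, 30), (15078416825, 38)]),
    (260161265138, [(390940505689, 4), (821754164710, 5), (961578551172, 6), (36231154441, 20), (50705191030, 30), (4043990612, 38)]),
    (130080632569, [(360921970402, 4), (1370596981271, 5), (2325904803943, 6), (37737624864, 20), (271749981574, 30), (2923990674, 38)]),
    (2927215740, [(8393522658, 4), (29983303044, 5), (44792077626, 10), (8434003788, 19), (446226097, 29), (12656045329, 30)]),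
    (683133238228, [(16776761007534, 5), (22623710825578, 6), (423204587196, 11), (11146854272294, 14), (247955230009, 20), (67782900355, 38)]),
    (3141833520, [(14468677068, 4), (164958228312, 5), (240758689242, 10), (467105119, 29), (71121280231, 30), (324198858, 38)])]

def certificatePos5 : Fin 54 → ℕ × List (ℕ × Fin 54) := ![

    (69118190069, [(16430422993, 5), (5357855406, 14), (1100941833, 18), (241475117, 21), (9167723934, 24), (68145678, 41)]),
    (7758546080, [(269063583, 5), (118276021, 14), (12147233, 15), (3698069, 21), (1008402621, 24), (55654135, 44)]),
    (17029304063, [(870393669, 4), (54748189293, 5), (41054391, 8), (1632867084, 15), (14658808265, 24), (4313297819, 51)]),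
    (495670631220, [(287185649821, 4), (1697174294791, 5), (160228887960, 10), (121095134250, 18), (7963786559, 38), (6325396919, 41)]),
    (70912702668, [(52987406271, 4), (472290074731, 5), (61085239327, 10), (30849321075, 18), (5094128189, 22), (18969285918, 25)]),
    (10002578590, [(63402232117, 5), (2516367880, 10), (5145273429, 18), (6320412970, 24), (2006881228, 25), (134917134, 41)]),
    (260161265138, [(122255233660, 4), (1716360470685, 5), (379093774342, 10), (82474785370, 18), (679574487640, 24), (4440214875, 41)]),
    (1209335409178, [(36487573182834, 5), (58312585720, 8), (11533943738688, 14), (5071418559015, 18), (89404764002, 24), (131007728465, 41)]),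
    (1209335409178, [(89854962787713, 5), (288259821890, 8), (25477554465564, 14), (12904008345927, 18), (10711062257836, 24), (346130859630, 41)]),
    (3200144967, [(1255480398, 4), (68334715827, 5), (2537954077, 15), (40782855322, 24), (963255207, 44), (4422652946, 51)]),
    (9710367958, [(68342200283, 5), (7901323328, 10), (12127582342, 14), (3825646801, 18), (17698983932, 24), (2643432058, 42)]),
    (1209335409178, [(35996480436225, 5), (133939210320, 8), (11153160852584, 14), (4997831364534, 18), (28840992132, 24), (94308804741, 41)]),
    (17029304063, [(12674751573, 4), (369381926214, 5), (40128619, 8), (13316585917, 15), (230378922562, 24), (21754446779, 51)]),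
    (4121715522, [(128855414838, 5), (3489777649, 21), (153936865346, 24), (60093021711, 44), (2358090473, 45), (66871514436, 49)]),
    (133455865140, [(771576954487, 5), (20032987312, 10), (208306492302, 14), (50141727684, 18), (5084506382, 22), (1623695151, 41)]),
    (729794461186, [(14909436220776, 5), (120997161414, 10), (304937567854, 11), (3432663757888, 14), (2110818744389, 18), (31862463025, 41)]),
    (260161265138, [(2298555479148, 4), (11978414268218, 5), (1166153639850, 10), (1620536079173, 18), (3268254036750, 24), (63736008783, 41)]),
    (34179911388, [(1161080375037, 5), (19358331378, 10), (343396258224, 14), (143823700227, 18), (368489308937, 24), (29628047117, 33)]),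
    (102175824378, [(158757019815, 4), (1915554200253, 5), (8293011375, 8), (18699593110, 15), (1106042570512, 24), (105940502633, 51)]),
    (5696651898, [(29700115950, 5), (2236204380, 10), (1177842126, 14), (2241949236, 18), (4010306563, 24), (581897227, 33)]),
    (292755598726, [(7340635997737, 5), (165460073384, 6), (2153399953006, 14), (994384066775, 18), (23190249120, 33), (26887250522, 41)]),
    (2060857761, [(26164878720, 5), (1256051966, 21), (17750983126, 24), (4769439030, 44), (1127928811, 45), (3170480604, 49)]),
    (4121715522, [(82536677382, 5), (1858518137, 21), (99840802732, 24), (44019973461, 44), (484109221, 45), (45005852124, 49)]),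
    (277000971, [(3982788946, 2), (2819097056, 5), (75433897, 14), (3847894589, 24), (15471306, 25), (1501459687, 44)]),
    (319526989, [(656245246, 5), (387117121, 24), (149088201, 44), (24345936, 45), (385555325, 49), (27128125, 51)]),
    (260161265138, [(827786583160, 4), (4496306344605, 5), (435718258500, 10), (517185018688, 18), (599730145962, 24), (17583850493, 41)]),
    (34179911388, [(1624348730931, 5), (23318786454, 10), (469445232624, 14), (208008138477, 18), (433627628075, 24), (41845031087, 33)]),
    (336259084, [(31481239, 4), (895614073, 5), (1395288461, 24), (646480452, 44), (11593439, 48), (1129720058, 49)]),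
    (58843567, [(513943995, 2), (298775616, 5), (7425624, 14), (303604322, 24), (336575, 38), (166541304, 44)]),
    (92333657, [(1039993607, 2), (757048420, 5), (74678698, 14), (1085912727, 24), (9599229, 25), (333286746, 44)]),
    (1631204681342, [(993482504505, 4), (5092416357262, 5), (591417987244, 10), (572509183856, 18), (114068634854, 33), (17548800439, 38)]),
    (101579063488, [(735104219753, 5), (124811143220, 10), (262267084668, 24), (58818670578, 25), (1985196519, 41), (159167596606, 48)]),
    (21456316, [(349455251, 5), (6660058, 10), (96314388, 14), (44908489, 18), (98098909, 24), (9282885, 33)]),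
    (17089955694, [(476913332067, 5), (12564099816, 10), (140760577338, 14), (55883559747, 18), (173392712726, 24), (11823752648, 33)]),
    (1147105231908, [(1507110683014, 4), (15313760123965, 5), (98166678503, 8), (7291113871500, 24), (43753600357, 38), (344954290793, 51)]),
    (46360054892, [(1057301651579, 2), (690932533753, 5), (759397485873, 24), (537602305, 38), (251350437, 41), (366955117480, 44)]),
    (1209335409178, [(3205352177181, 5), (12501620226, 8), (886659168276, 14), (413184119531, 18), (151503507422, 24), (8596106936, 41)]),
    (195295799522, [(123037740510, 4), (937873723395, 5), (120105964330, 10), (340982218808, 24), (6008712219, 41), (168964693118, 48)]),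
    (92720109784, [(5695325398415, 2), (4068977921995, 5), (4807888424397, 24), (2379481309, 38), (1253237199, 41), (2175361220536, 44)]),
    (277000971, [(954234068, 2), (392801356, 5), (105306209, 14), (836375899, 24), (14141304, 25), (167272391, 44)]),
    (9985873907, [(140886159, 4), (14238245356, 5), (400270347, 15), (651971047, 21), (10153872158, 24), (1849062309, 44)]),
    (17089955694, [(2399802617859, 5), (28492208736, 10), (697906270212, 14), (304073241681, 18), (653600718608, 24), (61388769350, 33)]),
    (3797767932, [(27791506041, 5), (447779394, 10), (8974640712, 14), (2954450271, 18), (13739399785, 24), (671767477, 33)]),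
    (4121715522, [(8495260914, 5), (167972075, 21), (10711003036, 24), (4327604907, 44), (90356215, 45), (4704874794, 49)]),
    (24247820879, [(8363439239, 4), (100395208874, 5), (14544508147, 10), (2216016865, 11), (1823064907, 18), (2583232580, 22)]),
    (130080632569, [(301540079111, 4), (1459159292897, 5), (101531174724, 10), (220058774870, 18), (168807260869, 24), (7706195134, 41)]),
    (8803842462, [(32055625623, 4), (211227445473, 5), (30629899620, 6), (102750055016, 24), (6595588361, 33), (35622848559, 48)]),
    (8544977847, [(434356181754, 5), (8922763653, 10), (123533553327, 14), (55008797637, 18), (117947657666, 24), (11088964358, 33)]),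
    (677445168012, [(1076494275823, 4), (9972092918566, 5), (16478725111, 8), (4379652327264, 24), (19370760895, 41), (728936619133, 51)]),
    (85739372505, [(323541795558, 5), (1610863404, 7), (175756297, 16), (43589146398, 24), (945953990, 41), (32946925544, 51)]),
    (2221928993, [(7707464881, 4), (41651604108, 5), (4367864349, 10), (5043540683, 18), (4334269403, 24), (819105213, 33)]),
    (1373905174, [(7791424626, 5), (363548887, 21), (6488503284, 24), (3115869869, 44), (198379105, 45), (4502961896, 49)]),
    (3761889917128, [(87673634562591, 2), (33852422013410, 5), (135363965531, 8), (50877130856, 13), (168180806976, 38), (13693170168821, 44)]),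
    (277000971, [(4720913857, 2), (5116011149, 5), (56842822, 14), (6405312560, 24), (12702492, 25), (2510950975, 44)])]

def certificateNeg5 : Fin 54 → ℕ × List (ℕ × Fin 54) := ![

    (33361217340, [(209866141, 4), (3932860562, 5), (1277310890, 6), (1165922842, 19), (1030570224, 30), (6427289, 38)]),
    (1295776665610, [(63650632806, 4), (443677533183, 5), (80351305048, 6), (2453175482, 13), (16137354312, 18), (1439463583, 41)]),
    (16116640086, [(54054317364, 5), (12096744006, 6), (19530942372, 14), (4929006822, 18), (5251038853, 24), (1105003147, 33)]),
    (34179911388, [(117273213087, 5), (5893810602, 10), (26777492124, 14), (1892135613, 18), (44918263349, 24), (2048013293, 33)]),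
    (260161265138, [(216378589378, 4), (1555314564744, 5), (235574988874, 10), (66897450201, 18), (721429450632, 24), (8083914903, 41)]),
    (17089955694, [(114074734800, 5), (2927486442, 10), (50187125172, 14), (11091242004, 18), (2051793085, 24), (2248684063, 33)]),
    (65097514134, [(547539183930, 5), (136441710536, 14), (13986945651, 22), (2146052776, 25), (2245824251, 41), (936466045, 51)]),
    (260161265138, [(870702901960, 4), (7414443333634, 5), (972465246368, 10), (177079931021, 18), (1703664304894, 24), (26304910351, 41)]),
    (260161265138, [(2377930381112, 4), (17926654688215, 5), (2743591460542, 10), (267773967047, 18), (2376990006712, 24), (43521200548, 41)]),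
    (2754151003258, [(101849765748357, 5), (17755629111950, 6), (29676466805812, 14), (6382116974526, 18), (178563970986, 38), (379434197637, 41)]),
    (11818783778, [(6447672538, 4), (80749273237, 5), (6806458432, 10), (7345800497, 18), (575236706, 22), (7545284256, 25)]),
    (53326295832, [(179009814636, 4), (1502058945987, 5), (195558311994, 10), (34116750585, 18), (344169958367, 24), (25621341287, 33)]),
    (35456351334, [(71989298334, 4), (1295148943561, 5), (385619659024, 10), (67446253275, 18), (14178045968, 22), (82414566234, 25)]),
    (247835315610, [(2636800249583, 4), (25633430598038, 5), (6791390108430, 10), (1181094678930, 18), (62234888857, 38), (98110487242, 41)]),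
    (26663147916, [(19559437008, 4), (133266029223, 5), (13912920666, 10), (9587326629, 18), (34596949531, 24), (3769209019, 33)]),
    (260161265138, [(551107891734, 4), (4907130473573, 5), (872524834546, 10), (40840467414, 18), (1533946533882, 24), (14979078459, 41)]),
    (10744426724, [(498172379750, 5), (25708650882, 6), (120810463200, 14), (13129682580, 18), (9755037745, 24), (5937319725, 33)]),
    (46477508676, [(128712725226, 4), (1463152718496, 5), (158482430934, 10), (33627360108, 20), (13103682319, 29), (6949395739, 30)]),
    (440596116640, [(2227126958111, 4), (12862542516381, 5), (3214939539200, 10), (1067178250540, 18), (8989802829, 38), (53288030499, 41)]),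
    (1209335409178, [(6702098476247, 5), (37338418458, 8), (2855797894266, 14), (636699946991, 18), (30952980684, 24), (9425072232, 41)]),
    (260161265138, [(891708311134, 4), (6080801736736, 5), (663570324558, 10), (158056845725, 18), (1540102597456, 24), (21362992739, 41)]),
    (292755598726, [(7183453978610, 5), (1482952107872, 6), (2075017680054, 14), (597476280367, 18), (87783631328, 33), (9402035041, 41)]),
    (247835315610, [(1570102431644, 4), (16727664628949, 5), (4422718894380, 10), (782099870610, 18), (41040218806, 38), (66581006131, 41)]),
    (259155333122, [(1587249936584, 4), (12017294339415, 5), (3304921136230, 6), (61620427298, 13), (615058360052, 18), (46291313135, 41)]),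
    (195295799522, [(67897415825, 4), (673145852277, 5), (265102218584, 10), (13467939163, 24), (3572201944, 41), (93016770497, 48)]),
    (34179911388, [(547526525037, 5), (22035174162, 10), (133060556508, 14), (25165942239, 18), (66661097777, 24), (10331629277, 33)]),
    (3162920827560, [(12875923429793, 4), (139368732481463, 5), (16249725403320, 10), (2194808459400, 11), (254692057027, 38), (38052973237, 41)]),
    (23238754338, [(36736553526, 4), (240582292356, 5), (79742865660, 6), (18620376486, 18), (12891713729, 24), (4728047051, 33)]),
    (259155333122, [(728392603910, 4), (5605000270098, 5), (1586797504257, 6), (15894825633, 13), (367355890637, 18), (23011475647, 41)]),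
    (1295776665610, [(6481786175686, 4), (50543601456753, 5), (13364975112013, 6), (368522643857, 13), (1945245919117, 18), (189186925938, 41)]),
    (4882844484, [(17061599481, 5), (296636226, 10), (3702434964, 14), (84781227, 18), (5290574609, 24), (242668061, 33)]),
    (266911730280, [(2246793733253, 5), (108513656108, 10), (493311389658, 14), (51072182496, 18), (440835358, 22), (5121275289, 41)]),
    (1295776665610, [(2601274953402, 4), (19779928118464, 5), (76582510708, 8), (2325019546332, 10), (57586078743, 20), (37735821497, 38)]),
    (23238754338, [(44604316971, 4), (595094727900, 5), (70593229008, 10), (10371095229, 20), (5278364911, 29), (34103235253, 30)]),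
    (292755598726, [(5985532732461, 5), (791615682728, 6), (1816942840422, 14), (534220154687, 18), (39007773254, 33), (17328831370, 41)]),
    (1295776665610, [(11326043600364, 4), (80915955485427, 5), (22612039323062, 6), (209751918478, 13), (5439966748248, 18), (325736237207, 41)]),
    (260161265138, [(67654121328, 4), (532666620663, 5), (88961208246, 10), (10999966619, 18), (117351259550, 24), (1728301718, 41)]),
    (32233280172, [(156663003204, 5), (8055615594, 6), (36269152776, 14), (4306118322, 18), (1263910613, 24), (1951952393, 33)]),
    (1295776665610, [(33648243283362, 4), (239111698560681, 5), (65921561585236, 6), (602717083394, 13), (16061574172524, 18), (957963583501, 41)]),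
    (1295776665610, [(1630904377828, 4), (14482828507689, 5), (3658673039784, 6), (171558025116, 13), (105115232686, 18), (48169906139, 41)]),
    (260161265138, [(127957854484, 4), (810529789553, 5), (200664882446, 10), (64990495818, 18), (26622699546, 24), (3167412941, 41)]),
    (308550782827, [(3324234176086, 4), (39663263822138, 5), (4783212393152, 10), (588095021471, 11), (172297280882, 20), (72145743297, 38)]),
    (975738580, [(291101742, 4), (5808389056, 5), (976776174, 10), (689953232, 19), (34734743, 29), (1197964331, 30)]),
    (793073009952, [(568755802949, 4), (5726844906767, 5), (1478496424416, 10), (249629943108, 18), (15426368671, 38), (22312775761, 41)]),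
    (260161265138, [(91165103564, 4), (912879181121, 5), (168991400694, 10), (4146333817, 18), (543857438250, 24), (3883486820, 41)]),
    (34179911388, [(400597385667, 5), (32620569882, 10), (84001707528, 14), (5869941573, 18), (62339188511, 24), (4988808467, 33)]),
    (1141064441964, [(29854079460781, 5), (2091985787440, 10), (158108104368, 11), (5555632598670, 14), (222080518382, 22), (47351481609, 41)]),
    (1581460413780, [(9462833571611, 4), (76126138838531, 5), (7732665373800, 10), (518671840920, 11), (164822562589, 38), (109289038849, 41)]),
    (2754151003258, [(61174330335315, 5), (9493016788498, 6), (17957032261278, 14), (5165529736292, 18), (41432140730, 38), (265877628165, 41)]),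
    (8058320043, [(30407975988, 5), (5213131503, 6), (13149730074, 14), (2611542051, 18), (3654050225, 24), (531080555, 33)]),
    (34179911388, [(621342398757, 5), (6345806178, 10), (158072479464, 14), (26593800099, 18), (76752902413, 24), (11271941869, 33)]),
    (793073009952, [(1347548200609, 4), (11760528783187, 5), (3666149383296, 10), (937825815732, 18), (1349989907, 38), (47758967021, 41)]),
    (1321788349920, [(4168473281909, 4), (50962591438799, 5), (12525888972960, 10), (1491374175300, 18), (195393449071, 38), (204110473201, 41)]),
    (37022190446, [(347084247848, 4), (2472392737195, 5), (685128818404, 6), (7362926978, 13), (162370490891, 18), (9993601882, 41)])]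

def certificatePos6 : Fin 54 → ℕ × List (ℕ × Fin 54) := ![

    (2012352381, [(3561690, 9), (23680635, 19), (13246544, 21), (75140512, 34), (78957938, 39), (7178494, 45)]),
    (1, [(1, 1)]),
    (42274824906, [(281894188, 14), (19285980003, 24), (366132550, 42), (20080266719, 51), (4081726248, 52), (579926673, 53)]),
    (455859764, [(174675017, 2), (10626727, 4), (1869812, 22), (171404557, 34), (302636476, 40), (168952148, 48)]),
    (429586801, [(257254919, 18), (168451205, 24), (1324560, 38), (42539766, 40), (303446883, 48), (101687126, 49)]),
    (11039793720, [(521662470, 5), (7427653572, 21), (5067440089, 24), (344275621, 34), (10294720, 38), (7366855116, 51)]),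
    (1, [(1, 9)]),
    (6340352010236, [(4173293818620, 10), (5867416482211, 12), (750628108179, 29), (41729336956347, 34), (410818576123, 38), (15657154399, 41)]),
    (486365873, [(538020124, 21), (1174471861, 30), (8243249910, 34), (2204211763, 39), (8053446687, 40), (781167219, 44)]),
    (691327416, [(11215459897, 1), (1258713, 8), (354359492, 13), (140437527, 22), (471522104, 27), (917465798, 51)]),
    (1, [(1, 12)]),
    (286515952817, [(270522369090, 6), (149351931046, 9), (135476348734, 18), (46189970521, 22), (1741107172096, 34), (20039947351, 38)]),
    (1, [(1, 13)]),
    (1655309396, [(78946918437, 1), (3531889, 8), (198511182, 13), (243603805, 22), (5262317040, 28), (4415761138, 52)]),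
    (1, [(1, 18)]),
    (7685302435951, [(229713925791, 11), (1988678708196, 14), (3091720335569, 18), (690745536020, 22), (36968405738791, 34), (424723456804, 38)]),
    (602370924, [(89977569, 13), (232953867, 21), (1791791810, 30), (6236703827, 34), (995608831, 39), (10529707677, 40)]),
    (324773568, [(946009715, 19), (246304483, 21), (859154271, 30), (1344223202, 34), (883600905, 39), (7196384859, 40)]),
    (1227502934, [(94499251, 9), (791944930, 13), (73377941, 21), (2979894092, 24), (892033909, 39), (18447342, 42)]),
    (1, [(1, 21)]),
    (140556307407, [(17242039077, 4), (80722680204, 18), (261988920686, 19), (128518639774, 21), (601698333572, 34), (13618860582, 38)]),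
    (1, [(1, 22)]),
    (6953078331, [(809374443, 14), (9699752069, 28), (1633059474, 38), (1207094876, 48), (7677320936, 52), (1161688997, 53)]),
    (338, [(2455, 1), (65, 38), (1202, 39)]), (1, [(1, 27)]),
    (315856711999, [(48220530315, 9), (41338634392, 13), (16054250491, 15), (290286263287, 18), (22347111590, 21), (910951198501, 34)]),
    (324773568, [(1112048623, 19), (356050463, 21), (1163522379, 30), (2065046410, 34), (1062747069, 39), (9545389815, 40)]),
    (1, [(1, 28)]), (1, [(1, 29)]), (169, [(3663, 1), (169, 24), (13, 38), (594, 39)]),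
    (1, [(1, 34)]),
    (62639807, [(22389310, 3), (5524725, 19), (23222358, 30), (99026627, 34), (18654435, 39), (330472696, 40)]),
    (162386784, [(184096409, 19), (58465033, 21), (230881533, 30), (306912326, 34), (155823483, 39), (2037825393, 40)]),
    (108257856, [(317351615, 19), (87364015, 21), (225087003, 30), (319050410, 34), (275811309, 39), (1926548871, 40)]),
    (8783692967, [(2063989248, 9), (1763300280, 18), (3199448989, 24), (695433419, 38), (6694039155, 40), (15429511569, 51)]),
    (3031, [(2237, 23), (619, 38), (10174, 39)]),
    (37979665553878, [(138173791120, 9), (547605634266, 13), (2491296775765, 18), (21453982471562, 34), (214913456420, 38), (59572679897, 41)]),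
    (401580616, [(1752781, 13), (30038247, 21), (114020286, 30), (465152503, 34), (105462891, 39), (541012893, 40)]),
    (1, [(1, 38), (12, 39)]), (1, [(13, 1), (1, 39)]), (1, [(1, 43)]),
    (324773568, [(3232464305, 19), (1110683905, 21), (3374592981, 30), (6165989942, 34), (3291410019, 39), (26708119593, 40)]),
    (324773568, [(298131799, 19), (57187847, 21), (193328211, 30), (210179578, 34), (300083829, 39), (1556951583, 40)]),
    (179168976, [(88553869, 1), (7765692, 22), (40611264, 28), (4494713, 38), (1492308, 44), (3400416, 52)]),
    (1, [(1, 48)]),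
    (59711463459, [(3091602360, 13), (8375891095, 30), (168297777914, 34), (1355128529, 38), (142864447413, 40), (25289405202, 44)]),
    (649547136, [(406321447, 19), (355417751, 21), (1290070179, 30), (2906818138, 34), (699661413, 39), (9876410031, 40)]),
    (81193392, [(324589195, 19), (109109723, 21), (301235127, 30), (523254802, 34), (283437345, 39), (2580352419, 40)]),
    (218098401411, [(71858990442, 9), (15602068001, 13), (365682528065, 24), (23806766640, 38), (5682016224, 42), (283761210596, 51)]),
    (1, [(1, 51)]),
    (18911255484248, [(13714397409606, 9), (1861353237642, 22), (61666499770965, 34), (187606198329, 38), (109027268545, 41), (13931969142373, 48)]),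
    (1, [(1, 52)]), (1, [(1, 53)]),
    (5206907982, [(394789224, 9), (379325760, 13), (3348763723, 24), (4822744693, 29), (999732025, 38), (18668427409, 39)])]

def certificateNeg6 : Fin 54 → ℕ × List (ℕ × Fin 54) := ![

    (7758546080, [(269063583, 5), (118276021, 14), (12147233, 15), (3698069, 21), (1008402621, 24), (55654135, 44)]),
    (38566160291, [(677517237, 4), (2554135487, 5), (122324396, 11), (690923921, 18), (237433714, 22), (4989407508, 24)]),
    (15758186790796, [(26509473914667, 5), (171784366353, 8), (1944119478011, 12), (144534358918, 13), (5012596117159, 14), (615760793507, 38)]),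
    (515148793657, [(30579957701, 4), (14478983433, 8), (25576924593, 9), (242261200997, 18), (1794962182, 21), (13295928262, 22)]),
    (430040138957, [(326833780344, 4), (3172160848, 6), (363072909274, 9), (41053680837, 20), (61964691026, 30), (5923739446, 38)]),
    (2544765355, [(2393175498, 6), (608992417, 12), (80382617, 16), (133363313, 20), (836501766, 34), (2624541992, 48)]),
    (49810879491, [(64123751012, 14), (5378754659, 15), (38191055583, 18), (9718616258, 21), (27877338136, 34), (177069434, 38)]),
    (186777201408, [(545573071761, 5), (270837084982, 14), (384986652540, 18), (801259639232, 24), (17080590851, 41), (605389690034, 51)]),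
    (260161265138, [(606557091680, 4), (835649711853, 5), (291049864660, 10), (1719660391348, 18), (7937911653696, 24), (56595293155, 41)]),
    (4990524380160, [(14988567490043, 4), (41929078026353, 5), (23126182767900, 18), (4333817240160, 21), (334617702817, 38), (247951904527, 41)]),
    (152010944398, [(215324065991, 4), (1688069284, 16), (117456146744, 18), (49605335464, 19), (67001909448, 21), (2278446329, 38)]),
    (103964388281, [(110994603541, 4), (264402766347, 5), (242005431130, 18), (472249240450, 24), (9536815510, 41), (279798521979, 51)]),
    (936105302990, [(1478286407712, 4), (9036442485423, 5), (4188229756087, 18), (433921404190, 22), (819432675664, 25), (30132898238, 38)]),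
    (43815730242, [(1268430657594, 5), (45516412338, 14), (86996147429, 24), (48755980421, 33), (527324896266, 48), (488614959468, 51)]),
    (71731031897, [(13556173575, 4), (12280011197, 18), (10925381475, 20), (29784205970, 21), (846044556, 22), (45455441350, 34)]),
    (6918499590, [(9966926706, 5), (13837287657, 18), (21777689330, 24), (1916486674, 25), (371844877, 41), (8197735800, 51)]),
    (51647987329, [(72218596855, 5), (111559000275, 10), (103678189023, 18), (1122145813698, 24), (7915977558, 41), (144780973603, 48)]),
    (50934450168, [(134124608565, 5), (155922991392, 10), (43547519510, 14), (1060700399728, 24), (2949126619, 41), (106265905498, 51)]),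
    (187221060598, [(270279842137, 4), (1710395344121, 5), (523622913567, 18), (108442431238, 22), (124015490056, 25), (9148061115, 38)]),
    (815745645085, [(457798269725, 4), (618605765630, 6), (183892273886, 9), (17648660729, 11), (518999442680, 18), (25846250530, 22)]),
    (308824457670, [(648228666958, 14), (50602982798, 16), (764223745875, 18), (341210417160, 21), (1251202197620, 24), (6293189715, 41)]),
    (8015710143284, [(40649957477521, 5), (1467633123514, 12), (3123744180476, 21), (56412642484, 38), (604419162175, 41), (40949471240940, 48)]),
    (118790328130, [(300174070283, 4), (2361564046931, 5), (25401388579, 8), (606244346534, 18), (4354652582, 38), (896014686541, 51)]),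
    (148180301730, [(281104367967, 4), (2641572755054, 5), (58131899627, 11), (39396259339, 21), (253094713904, 22), (2125225591314, 24)]),
    (3152052660960, [(1352515549687, 4), (4260495676147, 5), (21789040440, 10), (1082239586580, 12), (50814254573, 38), (4775245553, 41)]),
    (87483438391, [(106305782258, 4), (37678399457, 5), (172453194607, 18), (56662068398, 21), (87738790711, 24), (3941439466, 41)]),
    (34179911388, [(79573905483, 5), (26585078514, 10), (125085271344, 14), (87822405381, 18), (872487388025, 24), (16568724785, 33)]),
    (993448671218, [(3763380584121, 5), (260179173698, 14), (176964002086, 15), (807847801871, 18), (2664487354, 38), (1397326151494, 51)]),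
    (186777201408, [(1432104688257, 5), (285438565334, 14), (130306032444, 18), (161440451776, 24), (4694020435, 41), (775263525010, 51)]),
    (4939343391, [(9164727747, 4), (70366076314, 5), (1479121867, 11), (651837167, 21), (6941905732, 22), (62508261615, 24)]),
    (13806677757, [(1376748820, 14), (4913322258, 18), (3879149553, 24), (3094035724, 42), (2248018212, 49), (3634469264, 51)]),
    (1627614828, [(479877225, 5), (376257246, 10), (445599600, 14), (1083724023, 18), (6624712991, 24), (196389323, 33)]),
    (17089955694, [(12646466043, 5), (10263960312, 10), (18391548426, 14), (14450680155, 18), (158823907358, 24), (2766585152, 33)]),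
    (34179911388, [(60291931263, 5), (2147675910, 10), (98956225644, 14), (43562117901, 18), (549087646739, 24), (8351457815, 33)]),
    (416177484756, [(495272964169, 4), (2012664273322, 5), (151736198474, 15), (1004483376738, 18), (120640227262, 21), (36754300483, 38)]),
    (148180301730, [(330405527097, 4), (3761419694074, 5), (85448496817, 11), (50846736569, 21), (362524866664, 22), (2645042356614, 24)]),
    (27766500531, [(3997286526, 5), (6415989540, 18), (10874304581, 24), (2019052323, 25), (360063827, 33), (2599638357, 51)]),
    (266793663152, [(50389555555, 5), (8029939760, 8), (80724252490, 10), (1714553794, 13), (96380904607, 18), (632459287348, 24)]),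
    (74090150865, [(471667559499, 4), (5539343299888, 5), (128009704714, 11), (40727357648, 21), (542404210798, 22), (3985320626958, 24)]),
    (276472760276, [(581519790315, 5), (407106413188, 14), (73459904809, 18), (307137799150, 21), (768143583886, 24), (1624201912, 41)]),
    (4990524380160, [(1251014070101, 4), (3207093900671, 5), (1833302870820, 18), (694138884000, 21), (22942698319, 38), (23180291329, 41)]),
    (2441422242, [(18055944456, 5), (4853404698, 10), (26823652026, 14), (18113478006, 18), (182442071933, 24), (3433717337, 33)]),
    (2536050740730, [(2318000741622, 5), (2114617153416, 14), (13434096349937, 24), (68607069845, 33), (29382622806, 38), (11747586528, 41)]),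
    (993448671218, [(2038339211545, 5), (205515100552, 14), (113582343042, 15), (602200708133, 18), (2462837334, 38), (717958739914, 51)]),
    (17946652683902, [(5380568066022, 4), (177041683512, 8), (7325103891854, 9), (381777449604, 13), (1161835237619, 18), (111368676637, 41)]),
    (430040138957, [(173857321353, 5), (71733911537, 10), (26609429554, 11), (577988608574, 18), (1538470742619, 24), (14540827338, 41)]),
    (8544977847, [(8778221232, 5), (6814302441, 10), (11361943491, 14), (17028658011, 18), (104592919412, 24), (2786560820, 33)]),
    (8544977847, [(20806967292, 5), (5046900351, 10), (37163205276, 14), (25909963077, 18), (227577086726, 24), (4446341786, 33)]),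
    (936105302990, [(813416688371, 4), (6872233803339, 5), (1557049250601, 18), (464093026570, 22), (524751629682, 25), (62394112889, 38)]),
    (551338385664, [(179926991023, 4), (418959361572, 5), (283576486468, 6), (238540308510, 12), (2300090864, 16), (7221109401, 38)]),
    (276472760276, [(81589130509, 5), (486373694736, 14), (524425174773, 18), (281232058474, 21), (370585054422, 24), (14106039146, 41)]),
    (135924405574, [(174534217918, 4), (545746861115, 5), (158976684280, 12), (58019353575, 18), (10046625692, 33), (111787776378, 51)]),
    (993448671218, [(11259466709449, 5), (1215491295202, 14), (537685074338, 15), (2388434881435, 18), (6494678664, 38), (4854206336420, 51)]),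
    (29636060346, [(76481486253, 4), (800744156450, 5), (17867190209, 11), (10416437755, 21), (77875359626, 22), (559741029594, 24)])]

theorem stepMatrix_mulVec_mem_cone {k : ℕ} (hk : 0 < k) (hk' : k < 7) {v : Fin 6 → ℚ}
    (hv : v ∈ cone) :
    (stepMatrix k 1).map (Int.cast : ℤ → ℚ) *ᵥ v ∈ cone ∧
      (stepMatrix k (-1)).map (Int.cast : ℤ → ℚ) *ᵥ v ∈ cone := by
  have key : ∀ (c c' : Fin 54 → ℕ × List (ℕ × Fin 54)), Certifies (stepMatrix k 1) c →
      Certifies (stepMatrix k (-1)) c' → _ :=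
    fun c c' h h' => And.intro (h.mulVec_mem_cone hv) (h'.mulVec_mem_cone hv)
  interval_cases k
  · exact key certificatePos1 certificateNeg1 (by decide +kernel) (by decide +kernel)
  · exact key certificatePos2 certificateNeg2 (by decide +kernel) (by decide +kernel)
  · exact key certificatePos3 certificateNeg3 (by decide +kernel) (by decide +kernel)
  · exact key certificatePos4 certificateNeg4 (by decide +kernel) (by decide +kernel)
  · exact key certificatePos5 certificateNeg5 (by decide +kernel) (by decide +kernel)
  · exact key certificatePos6 certificateNeg6 (by decide +kernel) (by decide +kernel)

theorem add_mem_cone {v w : Fin 6 → ℚ} (hv : v ∈ cone) (hw : w ∈ cone) : v + w ∈ cone := by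
  intro i
  simpa [mul_add, Finset.sum_add_distrib] using add_pos (hv i) (hw i)

theorem smul_mem_cone {a : ℚ} (ha : 0 < a) {v : Fin 6 → ℚ} (hv : v ∈ cone) : a • v ∈ cone := by
  intro i
  have := mul_pos ha (hv i)
  simpa [Finset.mul_sum, mul_left_comm] using this

theorem pos_of_smul_mem_cone {a : ℚ} {v : Fin 6 → ℚ} (hv : v ∈ cone) (h : a • v ∈ cone) :
    0 < a := by
  have := h 0
  have h' : ∑ j, (coneForms 0 j : ℚ) * (a • v) j = a * ∑ j, (coneForms 0 j : ℚ) * v j := by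
    simp [Finset.mul_sum, mul_left_comm]
  rw [h'] at this
  exact pos_of_mul_pos_left this (hv 0).le

/-- The vector `direction` with rational entries. -/
def directionQ : Fin 6 → ℚ := fun i => direction i

theorem directionQ_mem_cone : directionQ ∈ cone := by
  have h : ∀ i, 0 < ∑ j, coneForms i j * direction j := by decide +kernel
  intro i
  have := h i
  simp only [directionQ]
  exact_mod_cast this

theorem stepMatrix_mulVec (k : ℕ) (ε : ℤ) (v : Fin 6 → ℚ) :
    (stepMatrix k ε).map (Int.cast : ℤ → ℚ) *ᵥ v =
      (-1 : ℚ) ^ k • ((ε : ℚ) • ((cyclotomicPow k).map (Int.cast : ℤ → ℚ) *ᵥ v) +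
        ((cyclotomicPow k).map (Int.cast : ℤ → ℚ) *ᵥ v) 0 • directionQ) := by
  ext i
  simp only [mulVec, dotProduct, Matrix.map_apply, stepMatrix, Pi.smul_apply, Pi.add_apply,
    smul_eq_mul, Finset.mul_sum, Finset.sum_mul, ← Finset.sum_add_distrib, directionQ]
  refine Finset.sum_congr rfl fun j _ => ?_
  push_cast
  ring

/-- On the cone, the first coordinate of `B ^ k v` has sign `(-1) ^ k`. -/
theorem pos_of_mem_cone {k : ℕ} (hk : 0 < k) (hk' : k < 7) {v : Fin 6 → ℚ} (hv : v ∈ cone) :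
    0 < (-1 : ℚ) ^ k * ((cyclotomicPow k).map (Int.cast : ℤ → ℚ) *ᵥ v) 0 := by
  obtain ⟨h₁, h₂⟩ := stepMatrix_mulVec_mem_cone hk hk' hv
  rw [stepMatrix_mulVec] at h₁ h₂
  have h := add_mem_cone h₁ h₂
  set w := (cyclotomicPow k).map (Int.cast : ℤ → ℚ) *ᵥ v
  have : (-1 : ℚ) ^ k • (((1 : ℤ) : ℚ) • w + w 0 • directionQ) +
      (-1 : ℚ) ^ k • (((-1 : ℤ) : ℚ) • w + w 0 • directionQ) =
        (2 * ((-1 : ℚ) ^ k * w 0)) • directionQ := by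
    ext i
    simp
    ring
  rw [this] at h
  linarith [pos_of_smul_mem_cone directionQ_mem_cone h]

theorem step_mem_cone {k : ℕ} (hk : 0 < k) (hk' : k < 7) {n : ℤ} (hn : n ≠ 0) {v w : Fin 6 → ℚ}
    (hv : v ∈ cone) (hw : w = (cyclotomicPow k).map (Int.cast : ℤ → ℚ) *ᵥ v) :
    w + ((n : ℚ) * w 0) • directionQ ∈ cone ∨ -(w + ((n : ℚ) * w 0) • directionQ) ∈ cone := by
  obtain ⟨h₁, h₂⟩ := stepMatrix_mulVec_mem_cone hk hk' hv
  have hpos := pos_of_mem_cone hk hk' hv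
  rw [stepMatrix_mulVec] at h₁ h₂
  rw [← hw] at h₁ h₂ hpos
  have enlarge : ∀ {m : ℚ} {x : Fin 6 → ℚ}, 1 ≤ m → x ∈ cone →
      x + ((m - 1) * ((-1 : ℚ) ^ k * w 0)) • directionQ ∈ cone := by
    intro m x hm hx
    rcases hm.eq_or_lt with rfl | hm
    · simpa using hx
    · exact add_mem_cone hx
        (smul_mem_cone (mul_pos (sub_pos.2 hm) hpos) directionQ_mem_cone)
  have signed : (-1 : ℚ) ^ k • (w + ((n : ℚ) * w 0) • directionQ) ∈ cone ∨
      -((-1 : ℚ) ^ k • (w + ((n : ℚ) * w 0) • directionQ)) ∈ cone := by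
    rcases lt_or_gt_of_ne hn with hn | hn
    · right
      have hm : (1 : ℚ) ≤ -n := by exact_mod_cast (by omega : 1 ≤ -n)
      convert enlarge hm h₂ using 1
      ext i
      simp
      ring
    · left
      have hm : (1 : ℚ) ≤ n := by exact_mod_cast (by omega : 1 ≤ n)
      convert enlarge hm h₁ using 1
      ext i
      simp
      ring
  rcases neg_one_pow_eq_or ℚ k with h | h
  · simpa only [h, one_smul] using signed
  · simpa only [h, neg_smul, one_smul, neg_neg] using signed.symm

/-! ### The two generators of the hypergeometric group -/

variable {A B : GL (Fin 6) ℚ}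

theorem coe_pow_eq_cyclotomicPow
    (hB : (B : Matrix (Fin 6) (Fin 6) ℚ) =
      companionMatrix 6 (X ^ 6 + X ^ 5 + X ^ 4 + X ^ 3 + X ^ 2 + X + 1)) (k : ℕ) :
    ((B ^ k : GL (Fin 6) ℚ) : Matrix (Fin 6) (Fin 6) ℚ) =
      (cyclotomicPow k).map (Int.cast : ℤ → ℚ) := by
  induction k with
  | zero =>
    have h : cyclotomicPow 0 = 1 := by decide +kernel
    simp [h]
  | succ k ih =>
    have h : (B : Matrix (Fin 6) (Fin 6) ℚ) = (cyclotomicPow 1).map (Int.cast : ℤ → ℚ) := by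
      rw [hB]
      ext i j
      fin_cases i <;> fin_cases j <;>
        simp [companionMatrix, cyclotomicPow, coeff_X, coeff_one, coeff_X_pow]
    rw [pow_succ, Units.val_mul, ih, h, ← cyclotomicPow_mul_one k]
    exact (Matrix.map_mul (L := cyclotomicPow k) (M := cyclotomicPow 1)
      (f := Int.castRingHom ℚ)).symm

theorem coe_mul_inv
    (hA : (A : Matrix (Fin 6) (Fin 6) ℚ) = companionMatrix 6 ((X - 1) ^ 4 * (X ^ 2 + 1)))
    (hB : (B : Matrix (Fin 6) (Fin 6) ℚ) =
      companionMatrix 6 (X ^ 6 + X ^ 5 + X ^ 4 + X ^ 3 + X ^ 2 + X + 1)) :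
    ((B * A⁻¹ : GL (Fin 6) ℚ) : Matrix (Fin 6) (Fin 6) ℚ) =
      1 + vecMulVec directionQ (Pi.single 0 1) := by
  have hf : ((X - 1) ^ 4 * (X ^ 2 + 1) : ℚ[X]) =
      X ^ 6 - C 4 * X ^ 5 + C 7 * X ^ 4 - C 8 * X ^ 3 + C 7 * X ^ 2 - C 4 * X + 1 := by
    simp only [map_ofNat]
    ring
  have h : (B : Matrix (Fin 6) (Fin 6) ℚ) =
      (1 + vecMulVec directionQ (Pi.single 0 1)) * (A : Matrix (Fin 6) (Fin 6) ℚ) := by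
    rw [add_mul, one_mul, vecMulVec_mul, single_one_vecMul, hA, hB, hf]
    ext i j
    fin_cases i <;> fin_cases j <;>
      simp [companionMatrix, vecMulVec_apply, directionQ, direction, coeff_X, coeff_one,
        coeff_X_pow] <;> norm_num
  rw [Units.val_mul, h, mul_assoc, ← Units.val_mul, mul_inv_cancel, Units.val_one, mul_one]

theorem zpow_mulVec {T : GL (Fin 6) ℚ}
    (hT : (T : Matrix (Fin 6) (Fin 6) ℚ) = 1 + vecMulVec directionQ (Pi.single 0 1))
    (n : ℤ) (v : Fin 6 → ℚ) :
    ((T ^ n : GL (Fin 6) ℚ) : Matrix (Fin 6) (Fin 6) ℚ) *ᵥ v =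
      v + ((n : ℚ) * v 0) • directionQ := by
  have h0 : directionQ 0 = 0 := by simp [directionQ, direction]
  have hT1 : ∀ v, (T : Matrix (Fin 6) (Fin 6) ℚ) *ᵥ v = v + v 0 • directionQ := by
    intro v
    ext i
    simp [hT, add_mulVec, vecMulVec_mulVec]
  have hpow : ∀ (m : ℕ) (v : Fin 6 → ℚ), ((T ^ m : GL (Fin 6) ℚ) : Matrix (Fin 6) (Fin 6) ℚ) *ᵥ v =
      v + ((m : ℚ) * v 0) • directionQ := by
    intro m v
    induction m with
    | zero => simp
    | succ m ih =>
      rw [pow_succ', Units.val_mul, ← mulVec_mulVec, ih, hT1]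
      ext i
      simp [h0]
      ring
  obtain ⟨m, rfl | rfl⟩ := n.eq_nat_or_neg
  · simpa using hpow m v
  · have := hpow m (v + (((-(m : ℤ) : ℤ) : ℚ) * v 0) • directionQ)
    have hv : v = ((T ^ m : GL (Fin 6) ℚ) : Matrix (Fin 6) (Fin 6) ℚ) *ᵥ
        (v + (((-(m : ℤ) : ℤ) : ℚ) * v 0) • directionQ) := by
      rw [this]
      ext i
      simp [h0]
    conv_lhs => rw [hv]
    rw [mulVec_mulVec, ← Units.val_mul, _root_.zpow_neg, zpow_natCast, inv_mul_cancel, Units.val_one,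
      one_mulVec]

/-- Images of `direction` under reduced words lie in the cone, up to sign. -/
theorem IsReduced.mulVec_mem_cone {T B : GL (Fin 6) ℚ}
    (hT : ∀ (n : ℤ) (v : Fin 6 → ℚ), ((T ^ n : GL (Fin 6) ℚ) : Matrix (Fin 6) (Fin 6) ℚ) *ᵥ v =
      v + ((n : ℚ) * v 0) • directionQ)
    (hB : ∀ k, ((B ^ k : GL (Fin 6) ℚ) : Matrix (Fin 6) (Fin 6) ℚ) =
      (cyclotomicPow k).map (Int.cast : ℤ → ℚ))
    {ψ : Monoid.Coprod (Multiplicative ℤ) (Multiplicative (ZMod 7)) →* GL (Fin 6) ℚ}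
    (hl : ∀ n, ψ (Monoid.Coprod.inl n) = T ^ n.toAdd)
    (hr : ∀ b, ψ (Monoid.Coprod.inr b) = B ^ b.toAdd.val)
    {s : Monoid.Coprod (Multiplicative ℤ) (Multiplicative (ZMod 7))} (hs : IsReduced s) :
    ((ψ s : Matrix (Fin 6) (Fin 6) ℚ) *ᵥ directionQ ∈ cone ∨
      -((ψ s : Matrix (Fin 6) (Fin 6) ℚ) *ᵥ directionQ) ∈ cone) ∧
      (s = 1 ∨ ((ψ s : Matrix (Fin 6) (Fin 6) ℚ) *ᵥ directionQ) 0 ≠ 0) := by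
  induction hs with
  | one => exact ⟨.inl (by simpa using directionQ_mem_cone), .inl rfl⟩
  | @mul n b s hn hb hs ih =>
    have h0 : directionQ 0 = 0 := by simp [directionQ, direction]
    have hn' : n.toAdd ≠ 0 := hn
    have hk : 0 < b.toAdd.val := Nat.pos_of_ne_zero fun h => hb ((ZMod.val_eq_zero b.toAdd).1 h)
    have hk' : b.toAdd.val < 7 := ZMod.val_lt _
    rw [map_mul, map_mul, hl, hr, Units.val_mul, Units.val_mul, ← mulVec_mulVec, ← mulVec_mulVec,
      hT, hB]
    set v := (ψ s : Matrix (Fin 6) (Fin 6) ℚ) *ᵥ directionQ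
    rcases ih.1 with hv | hv
    · refine ⟨step_mem_cone hk hk' hn' hv rfl, .inr ?_⟩
      have := (pos_of_mem_cone hk hk' hv).ne'
      simpa [h0] using this
    · have hmem := step_mem_cone hk hk' hn' hv rfl
      have hne := (pos_of_mem_cone hk hk' hv).ne'
      rw [mulVec_neg] at hmem hne
      refine ⟨?_, .inr ?_⟩
      · convert hmem.symm using 2 <;> ext i <;> simp <;> ring
      · simpa [h0] using hne

end HypergeometricC19

open HypergeometricC19 in
/-- The hypergeometric group of case C19 is isomorphic to `ℤ ∗ ℤ/7ℤ`, freely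
generated by `T = B * A⁻¹` (of infinite order) and `B` (of order 7). -/
theorem thm_C19 (A B : GL (Fin 6) ℚ)
    (hA : (A : Matrix (Fin 6) (Fin 6) ℚ) = companionMatrix 6 ((X - 1) ^ 4 * (X ^ 2 + 1)))
    (hB : (B : Matrix (Fin 6) (Fin 6) ℚ) = companionMatrix 6 (X ^ 6 + X ^ 5 + X ^ 4 + X ^ 3 + X ^ 2 + X + 1)) :
    B ^ 7 = 1 ∧ B ≠ 1 ∧ ¬ IsOfFinOrder (B * A⁻¹) ∧
      ∀ ψ : Monoid.Coprod (Multiplicative ℤ) (Multiplicative (ZMod 7)) →* GL (Fin 6) ℚ,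
        ψ (Monoid.Coprod.inl (Multiplicative.ofAdd (1 : ℤ))) = B * A⁻¹ →
        ψ (Monoid.Coprod.inr (Multiplicative.ofAdd (1 : ZMod 7))) = B →
        Function.Injective ψ := by
  have hBk := coe_pow_eq_cyclotomicPow hB
  have hT := zpow_mulVec (coe_mul_inv hA hB)
  have hd : directionQ 0 = 0 := by simp [directionQ, direction]
  have hB7 : B ^ 7 = 1 := by
    ext1
    rw [hBk, ← cyclotomicPow_mod, ← hBk, pow_zero]
  have zpow_eq_one : ∀ n : ℤ, (B * A⁻¹) ^ n = 1 → n = 0 := by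
    intro n hn
    have h := congrFun (hT n (Pi.single 0 1)) 1
    rw [hn] at h
    simpa [directionQ, direction] using h
  refine ⟨hB7, ?_, ?_, ?_⟩
  · intro h
    have := pos_of_mem_cone one_pos (by norm_num) directionQ_mem_cone
    rw [← hBk, h] at this
    simp [hd] at this
  · rw [isOfFinOrder_iff_pow_eq_one]
    rintro ⟨n, hn, h⟩
    have := zpow_eq_one n (by simpa using h)
    omega
  · intro ψ hψT hψB
    have hl : ∀ n, ψ (Monoid.Coprod.inl n) = (B * A⁻¹) ^ n.toAdd := by
      intro n
      rw [← hψT, ← map_zpow, ← map_zpow, ← ofAdd_zsmul]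
      simp
    have hr : ∀ b, ψ (Monoid.Coprod.inr b) = B ^ b.toAdd.val := by
      intro b
      conv_rhs => rw [← hψB]
      rw [← map_pow, ← map_pow, ← ofAdd_nsmul]
      simp
    rw [injective_iff_map_eq_one]
    intro x hx
    obtain ⟨b, s, n, hs, rfl⟩ := exists_isReduced x
    obtain ⟨hcone, hne⟩ := hs.mulVec_mem_cone hT hBk hl hr
    rw [map_mul, map_mul, hl, hr] at hx
    set k := b.toAdd.val
    have hk7 : k < 7 := ZMod.val_lt _
    have hfix : ((B ^ k : GL (Fin 6) ℚ) : Matrix (Fin 6) (Fin 6) ℚ) *ᵥ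
        ((ψ s : Matrix (Fin 6) (Fin 6) ℚ) *ᵥ directionQ) = directionQ := by
      have h := congrArg (fun g : GL (Fin 6) ℚ => (g : Matrix (Fin 6) (Fin 6) ℚ) *ᵥ directionQ) hx
      simpa only [Units.val_mul, ← mulVec_mulVec, hT, hd, mul_zero, zero_smul, add_zero,
        Units.val_one, one_mulVec] using h
    have hb : b = 1 := by
      by_contra hb
      have hk : 0 < k := Nat.pos_of_ne_zero fun h => hb ((ZMod.val_eq_zero b.toAdd).1 h)
      rw [hBk] at hfix
      rcases hcone with h | h
      · have := pos_of_mem_cone hk hk7 h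
        simp [hfix, hd] at this
      · have := pos_of_mem_cone hk hk7 h
        rw [mulVec_neg, hfix] at this
        simp [hd] at this
    have hk0 : k = 0 := by simp [k, hb]
    rw [hk0, pow_zero] at hfix hx
    rw [Units.val_one, one_mulVec] at hfix
    rcases hne with rfl | hne
    · have hn : n = 1 := zpow_eq_one n.toAdd (by simpa using hx)
      simp [hb, hn]
    · exact absurd (by rw [hfix, hd]) hne
end

section
/- Let A be the companion matrix of f(x) = (x−1)⁴(x²−x+1) and B the companion matrix of the ninth cyclotomic polynomial g(x) = x⁶+x³+1, regarded as elements of GL₆(ℚ), and set T = B·A⁻¹. Then B⁹ = I, B has order 9, T has infinite order, and the group homomorphism from the free product ℤ ∗ (ℤ/9ℤ) to GL₆(ℚ) sending the generator 1 of ℤ to T and the generator 1 of ℤ/9ℤ to B is injective; in particular the group ⟨A,B⟩ is isomorphic to ℤ ∗ ℤ/9ℤ. (This is the hypergeometric monodromy group of case C-34, with α = (0,0,0,0,1/6,5/6) and β = (1/9,2/9,4/9,5/9,7/9,8/9).) -/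
open Matrix Polynomial

section FreeProduct

open scoped Pointwise Function

/-- The two factors of a binary free product, as a family indexed by `Bool`. -/
def boolFamily (G H : Type) (b : Bool) : Type := cond b G H

instance (G H : Type) [Group G] [Group H] : ∀ b, Group (boolFamily G H b)
  | true => inferInstanceAs (Group G)
  | false => inferInstanceAs (Group H)

/-- The ping-pong lemma for the free product of two groups. -/
theorem Monoid.Coprod.injective_of_ping_pong {G H : Type} {K α : Type*} [Group G] [Group H]
    [Group K] [MulAction K α] (ψ : Monoid.Coprod G H →* K) (hcard : 3 ≤ Cardinal.mk H)
    {X Y : Set α} (hX : X.Nonempty) (hY : Y.Nonempty) (hXY : Disjoint X Y)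
    (hG : ∀ g : G, g ≠ 1 → ∀ y ∈ Y, ψ (inl g) • y ∈ X)
    (hH : ∀ h : H, h ≠ 1 → ∀ x ∈ X, ψ (inr h) • x ∈ Y) :
    Function.Injective ψ := by
  let f : ∀ b, boolFamily G H b →* K := fun b =>
    match b with
    | true => ψ.comp inl
    | false => ψ.comp inr
  let fromG : G →* Monoid.CoprodI (boolFamily G H) :=
    Monoid.CoprodI.of (M := boolFamily G H) (i := true)
  let fromH : H →* Monoid.CoprodI (boolFamily G H) :=
    Monoid.CoprodI.of (M := boolFamily G H) (i := false)
  let inclusion : ∀ b, boolFamily G H b →* Monoid.Coprod G H := fun b =>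
    match b with
    | true => inl
    | false => inr
  have hinclusion : (Monoid.CoprodI.lift inclusion).comp (lift fromG fromH) =
      MonoidHom.id _ := by
    refine hom_ext (MonoidHom.ext fun g => ?_) (MonoidHom.ext fun h => ?_)
    · exact Monoid.CoprodI.lift_of inclusion (i := true) g
    · exact Monoid.CoprodI.lift_of inclusion (i := false) h
  have hψ : ψ = (Monoid.CoprodI.lift f).comp (lift fromG fromH) := by
    refine hom_ext (MonoidHom.ext fun g => ?_) (MonoidHom.ext fun h => ?_)
    · exact (Monoid.CoprodI.lift_of (M := boolFamily G H) (i := true) f g).symm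
    · exact (Monoid.CoprodI.lift_of (M := boolFamily G H) (i := false) f h).symm
  have hinj : Function.Injective (lift fromG fromH) :=
    Function.LeftInverse.injective (DFunLike.congr_fun hinclusion)
  rw [hψ, MonoidHom.coe_comp]
  refine Function.Injective.comp ?_ hinj
  refine Monoid.CoprodI.lift_injective_of_ping_pong f (Or.inr ⟨false, hcard⟩)
    (fun b => cond b X Y) ?_ ?_ ?_
  · rintro (_ | _)
    exacts [hY, hX]
  · rintro (_ | _) (_ | _) hne
    exacts [absurd rfl hne, hXY.symm, hXY, absurd rfl hne]
  · rintro (_ | _) (_ | _) hne h hh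
    · exact absurd rfl hne
    · rintro _ ⟨x, hx, rfl⟩
      exact hH h hh x hx
    · rintro _ ⟨y, hy, rfl⟩
      exact hG h hh y hy
    · exact absurd rfl hne

end FreeProduct

namespace C34

/-- Multiplication by `x` on `ℚ[x] / (x ^ 6 + x ^ 3 + 1)`, in the monomial basis. -/
def rot (v : Fin 6 → ℚ) : Fin 6 → ℚ := ![-v 5, v 0, v 1, v 2 - v 5, v 3, v 4]

/-- The `c`-th power of the transvection `B * A⁻¹`. -/
def shear (c : ℚ) (v : Fin 6 → ℚ) : Fin 6 → ℚ :=
  ![v 0, v 1 + 5 * (c * v 0), v 2 - 11 * (c * v 0), v 3 + 15 * (c * v 0),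
    v 4 - 11 * (c * v 0), v 5 + 5 * (c * v 0)]

/-- An involution that inverts both `rot` and `shear c`. -/
def refl (v : Fin 6 → ℚ) : Fin 6 → ℚ := ![v 0, -v 5, -v 4, v 0 - v 3, -v 2, -v 1]

/-- An open polyhedral cone with nine facets, mapped into itself up to sign by every
`shear 1 ∘ rot^[j]` and every `shear 1 ∘ rot^[j] ∘ refl` with `1 ≤ j ≤ 8`. -/
def cone : Set (Fin 6 → ℚ) := {v |
  0 < -2 * v 0 + v 1 + v 2 + v 3 + v 4 + v 5 ∧
  0 < 3 * v 0 + 2 * v 1 + v 2 - v 4 - 2 * v 5 ∧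
  0 < -5 * v 0 - 6 * v 1 - 6 * v 2 - 2 * v 3 + 3 * v 4 + 6 * v 5 ∧
  0 < -v 0 + 2 * v 1 + 3 * v 2 + 2 * v 3 - v 4 - 3 * v 5 ∧
  0 < 2 * v 1 + 2 * v 2 + 3 * v 3 + 2 * v 4 - v 5 ∧
  0 < -2 * v 1 - 6 * v 2 - 6 * v 3 - 2 * v 4 + 3 * v 5 ∧
  0 < -3 * v 0 - 4 * v 1 - 2 * v 2 + 2 * v 4 + 4 * v 5 ∧
  0 < 4 * v 0 + 6 * v 1 + 3 * v 2 - 2 * v 3 - 6 * v 4 - 6 * v 5 ∧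
  0 < 3 * v 0 + 3 * v 1 - 2 * v 2 - 6 * v 3 - 6 * v 4 - 2 * v 5}

/-- The union of `cone` and its negative. -/
def doubleCone : Set (Fin 6 → ℚ) := {v | v ∈ cone ∨ -v ∈ cone}

/-- The ping-pong set of the transvection. -/
def table : Set (Fin 6 → ℚ) := {v | v ∈ doubleCone ∨ refl v ∈ doubleCone}

theorem rot_neg (v : Fin 6 → ℚ) : rot (-v) = -rot v := by
  ext i; fin_cases i <;> simp [rot]; ring

theorem shear_neg (c : ℚ) (v : Fin 6 → ℚ) : shear c (-v) = -shear c v := by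
  ext i; fin_cases i <;> simp [shear] <;> ring

theorem refl_neg (v : Fin 6 → ℚ) : refl (-v) = -refl v := by
  ext i; fin_cases i <;> simp [refl]; ring

theorem refl_refl (v : Fin 6 → ℚ) : refl (refl v) = v := by
  ext i; fin_cases i <;> simp [refl]

theorem refl_shear (c : ℚ) (v : Fin 6 → ℚ) : refl (shear c v) = shear (-c) (refl v) := by
  ext i; fin_cases i <;> simp [refl, shear] <;> ring

theorem shear_shear (c d : ℚ) (v : Fin 6 → ℚ) : shear c (shear d v) = shear (c + d) v := by
  ext i; fin_cases i <;> simp [shear] <;> ring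

theorem rot_iterate_three (v : Fin 6 → ℚ) :
    rot^[3] v = ![-v 3, -v 4, -v 5, v 0 - v 3, v 1 - v 4, v 2 - v 5] := by
  simp only [rot, Function.iterate_succ, Function.iterate_zero, Function.comp_apply, id_eq,
    cons_val]

theorem rot_iterate_nine (v : Fin 6 → ℚ) : rot^[9] v = v := by
  rw [show 9 = 3 + (3 + 3) from rfl, Function.iterate_add_apply, Function.iterate_add_apply,
    rot_iterate_three, rot_iterate_three, rot_iterate_three]
  ext i; fin_cases i <;> simp <;> ring

theorem rot_refl_rot (v : Fin 6 → ℚ) : rot (refl (rot v)) = refl v := by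
  ext i; fin_cases i <;> simp [rot, refl] <;> ring

theorem rot_iterate_neg (j : ℕ) (v : Fin 6 → ℚ) : rot^[j] (-v) = -rot^[j] v :=
  (Function.Semiconj.iterate_right (f := Neg.neg) (fun v => (rot_neg v).symm) j v).symm

theorem rot_iterate_refl_rot_iterate (j : ℕ) (v : Fin 6 → ℚ) :
    rot^[j] (refl (rot^[j] v)) = refl v := by
  induction j generalizing v with
  | zero => rfl
  | succ j ih =>
    rw [Function.iterate_succ_apply, Function.iterate_succ_apply', rot_refl_rot, ih]

theorem refl_rot_iterate {j : ℕ} (hj : j ≤ 9) (v : Fin 6 → ℚ) :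
    refl (rot^[j] v) = rot^[9 - j] (refl v) := by
  rw [← rot_iterate_refl_rot_iterate j v, ← Function.iterate_add_apply, Nat.sub_add_cancel hj,
    rot_iterate_nine]

theorem neg_mem_doubleCone {v : Fin 6 → ℚ} : -v ∈ doubleCone ↔ v ∈ doubleCone := by
  simp [doubleCone, or_comm]

theorem pos_of_mem_cone {v : Fin 6 → ℚ} (hv : v ∈ cone) : 0 < v 0 := by
  obtain ⟨h0, h1, h2, h3, h4, h5, h6, h7, h8⟩ := hv
  linarith

theorem shear_mem_cone {c : ℚ} (hc : 0 ≤ c) {v : Fin 6 → ℚ} (hv : v ∈ cone) :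
    shear c v ∈ cone := by
  have h := mul_nonneg hc (pos_of_mem_cone hv).le
  obtain ⟨h0, h1, h2, h3, h4, h5, h6, h7, h8⟩ := hv
  simp only [cone, shear, Set.mem_ofPred_eq, cons_val]
  refine ⟨?_, ?_, ?_, ?_, ?_, ?_, ?_, ?_, ?_⟩ <;> linarith

theorem shear_rot_mem_doubleCone_of_mem_cone {j : ℕ} (hj : 1 ≤ j) (hj' : j ≤ 8)
    {v : Fin 6 → ℚ} (hv : v ∈ cone) : shear 1 (rot^[j] v) ∈ doubleCone := by
  obtain ⟨h0, h1, h2, h3, h4, h5, h6, h7, h8⟩ := hv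
  interval_cases j
  on_goal 1 => right
  on_goal 2 => left
  on_goal 3 => right
  on_goal 4 => left
  on_goal 5 => right
  on_goal 6 => left
  on_goal 7 => right
  on_goal 8 => left
  all_goals
    simp only [cone, shear, rot, Function.iterate_succ, Function.iterate_zero,
      Function.comp_apply, id_eq, Set.mem_ofPred_eq, Pi.neg_apply, cons_val]
    refine ⟨?_, ?_, ?_, ?_, ?_, ?_, ?_, ?_, ?_⟩ <;> linarith

theorem shear_rot_refl_mem_doubleCone_of_mem_cone {j : ℕ} (hj : 1 ≤ j) (hj' : j ≤ 8)
    {v : Fin 6 → ℚ} (hv : v ∈ cone) : shear 1 (rot^[j] (refl v)) ∈ doubleCone := by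
  obtain ⟨h0, h1, h2, h3, h4, h5, h6, h7, h8⟩ := hv
  interval_cases j
  on_goal 1 => left
  on_goal 2 => right
  on_goal 3 => left
  on_goal 4 => right
  on_goal 5 => left
  on_goal 6 => right
  on_goal 7 => left
  on_goal 8 => right
  all_goals
    simp only [cone, shear, rot, refl, Function.iterate_succ, Function.iterate_zero,
      Function.comp_apply, id_eq, Set.mem_ofPred_eq, Pi.neg_apply, cons_val]
    refine ⟨?_, ?_, ?_, ?_, ?_, ?_, ?_, ?_, ?_⟩ <;> linarith

theorem abs_lt_abs_rot_of_mem_cone {j : ℕ} (hj : 1 ≤ j) (hj' : j ≤ 8)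
    {v : Fin 6 → ℚ} (hv : v ∈ cone) : |v 0| < |(rot^[j] v) 0| := by
  rw [abs_of_pos (pos_of_mem_cone hv), lt_abs]
  obtain ⟨h0, h1, h2, h3, h4, h5, h6, h7, h8⟩ := hv
  interval_cases j
  on_goal 1 => right
  on_goal 2 => left
  on_goal 3 => right
  on_goal 4 => left
  on_goal 5 => right
  on_goal 6 => left
  on_goal 7 => right
  on_goal 8 => left
  all_goals
    simp only [rot, Function.iterate_succ, Function.iterate_zero, Function.comp_apply, id_eq,
      cons_val]
    linarith

theorem shear_mem_doubleCone {c : ℚ} (hc : 0 ≤ c) {v : Fin 6 → ℚ} (hv : v ∈ doubleCone) :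
    shear c v ∈ doubleCone :=
  hv.imp (shear_mem_cone hc) fun h => shear_neg c v ▸ shear_mem_cone hc h

theorem refl_mem_table {v : Fin 6 → ℚ} (hv : v ∈ table) : refl v ∈ table :=
  hv.elim (fun h => Or.inr ((refl_refl v).symm ▸ h)) Or.inl

theorem shear_rot_mem_doubleCone {j : ℕ} (hj : 1 ≤ j) (hj' : j ≤ 8) {v : Fin 6 → ℚ}
    (hv : v ∈ table) : shear 1 (rot^[j] v) ∈ doubleCone := by
  rcases hv with (h | h) | h | h
  · exact shear_rot_mem_doubleCone_of_mem_cone hj hj' h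
  · rw [← neg_mem_doubleCone, ← shear_neg, ← rot_iterate_neg]
    exact shear_rot_mem_doubleCone_of_mem_cone hj hj' h
  · rw [← refl_refl v]
    exact shear_rot_refl_mem_doubleCone_of_mem_cone hj hj' h
  · rw [← refl_refl v, ← neg_mem_doubleCone, ← shear_neg, ← rot_iterate_neg, ← refl_neg]
    exact shear_rot_refl_mem_doubleCone_of_mem_cone hj hj' h

theorem shear_one_le_rot_mem_doubleCone {c : ℚ} (hc : 1 ≤ c) {j : ℕ} (hj : 1 ≤ j) (hj' : j ≤ 8)
    {v : Fin 6 → ℚ} (hv : v ∈ table) : shear c (rot^[j] v) ∈ doubleCone := by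
  rw [← sub_add_cancel c 1, ← shear_shear]
  exact shear_mem_doubleCone (sub_nonneg.mpr hc) (shear_rot_mem_doubleCone hj hj' hv)

theorem shear_rot_mem_table {k : ℤ} (hk : k ≠ 0) {j : ℕ} (hj : 1 ≤ j) (hj' : j ≤ 8)
    {v : Fin 6 → ℚ} (hv : v ∈ table) : shear k (rot^[j] v) ∈ table := by
  rcases hk.lt_or_gt with hk | hk
  · right
    rw [refl_shear, refl_rot_iterate (by omega)]
    refine shear_one_le_rot_mem_doubleCone ?_ (by omega) (by omega) (refl_mem_table hv)
    exact_mod_cast (by omega : 1 ≤ -k)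
  · left
    refine shear_one_le_rot_mem_doubleCone ?_ hj hj' hv
    exact_mod_cast (by omega : 1 ≤ k)

theorem abs_lt_abs_rot_of_mem_doubleCone {j : ℕ} (hj : 1 ≤ j) (hj' : j ≤ 8)
    {v : Fin 6 → ℚ} (hv : v ∈ doubleCone) : |v 0| < |(rot^[j] v) 0| := by
  rcases hv with h | h
  · exact abs_lt_abs_rot_of_mem_cone hj hj' h
  · simpa [rot_iterate_neg] using abs_lt_abs_rot_of_mem_cone hj hj' h

theorem abs_lt_abs_rot {j : ℕ} (hj : 1 ≤ j) (hj' : j ≤ 8)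
    {v : Fin 6 → ℚ} (hv : v ∈ table) : |v 0| < |(rot^[j] v) 0| := by
  rcases hv with h | h
  · exact abs_lt_abs_rot_of_mem_doubleCone hj hj' h
  · have := abs_lt_abs_rot_of_mem_doubleCone (j := 9 - j) (by omega) (by omega) h
    rwa [← refl_rot_iterate (by omega)] at this

theorem rot_not_mem_table {j : ℕ} (hj : 1 ≤ j) (hj' : j ≤ 8) {v : Fin 6 → ℚ} (hv : v ∈ table) :
    rot^[j] v ∉ table := by
  intro h
  have h1 := abs_lt_abs_rot hj hj' hv
  have h2 := abs_lt_abs_rot (j := 9 - j) (by omega) (by omega) h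
  rw [← Function.iterate_add_apply, Nat.sub_add_cancel (by omega), rot_iterate_nine] at h2
  exact h1.asymm h2

theorem table_nonempty : table.Nonempty :=
  ⟨![1, 7, -16, 22, -16, 8], Or.inl (Or.inl (by
    simp only [cone, Set.mem_ofPred_eq, cons_val]
    norm_num))⟩

theorem rot_eq_mulVec (v : Fin 6 → ℚ) :
    companionMatrix 6 (X ^ 6 + X ^ 3 + 1 : ℚ[X]) *ᵥ v = rot v := by
  ext i
  fin_cases i <;>
    simp [companionMatrix, rot, mulVec, dotProduct, Fin.sum_univ_six, coeff_X_pow,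
      Polynomial.coeff_one]
  ring

theorem expand_charpoly : ((X - 1) ^ 4 * (X ^ 2 - X + 1) : ℚ[X]) =
    X ^ 6 - C 5 * X ^ 5 + C 11 * X ^ 4 - C 14 * X ^ 3 + C 11 * X ^ 2 - C 5 * X + C 1 := by
  simp only [map_ofNat, map_one]
  ring

theorem shear_mulVec (v : Fin 6 → ℚ) :
    shear 1 (companionMatrix 6 ((X - 1) ^ 4 * (X ^ 2 - X + 1) : ℚ[X]) *ᵥ v) = rot v := by
  rw [expand_charpoly]
  ext i
  fin_cases i <;>
    simp [companionMatrix, shear, rot, mulVec, dotProduct, Fin.sum_univ_six, coeff_X_pow,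
      coeff_X, Polynomial.coeff_one]
  ring

end C34

/-- The hypergeometric group of case C34 is isomorphic to `ℤ ∗ ℤ/9ℤ`, freely
generated by `T = B * A⁻¹` (of infinite order) and `B` (of order 9). -/
theorem thm_C34 (A B : GL (Fin 6) ℚ)
    (hA : (A : Matrix (Fin 6) (Fin 6) ℚ) = companionMatrix 6 ((X - 1) ^ 4 * (X ^ 2 - X + 1)))
    (hB : (B : Matrix (Fin 6) (Fin 6) ℚ) = companionMatrix 6 (X ^ 6 + X ^ 3 + 1)) :
    B ^ 9 = 1 ∧ orderOf B = 9 ∧ ¬ IsOfFinOrder (B * A⁻¹) ∧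
      ∀ ψ : Monoid.Coprod (Multiplicative ℤ) (Multiplicative (ZMod 9)) →* GL (Fin 6) ℚ,
        ψ (Monoid.Coprod.inl (Multiplicative.ofAdd (1 : ℤ))) = B * A⁻¹ →
        ψ (Monoid.Coprod.inr (Multiplicative.ofAdd (1 : ZMod 9))) = B →
        Function.Injective ψ := by
  let L : GL (Fin 6) ℚ →* LinearMap.GeneralLinearGroup ℚ (Fin 6 → ℚ) :=
    Matrix.GeneralLinearGroup.toLin.toMonoidHom
  have hL : Function.Injective L := Matrix.GeneralLinearGroup.toLin.injective
  have hLsmul (M : GL (Fin 6) ℚ) (v : Fin 6 → ℚ) :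
      L M • v = (M : Matrix (Fin 6) (Fin 6) ℚ) *ᵥ v := rfl
  have hBsmul (v : Fin 6 → ℚ) : L B • v = C34.rot v := by
    rw [hLsmul, hB, C34.rot_eq_mulVec]
  have hBpow (j : ℕ) (v : Fin 6 → ℚ) : L (B ^ j) • v = C34.rot^[j] v := by
    rw [map_pow, ← congrFun (smul_iterate (L B) j) v, ← funext hBsmul]
  have hTsmul (v : Fin 6 → ℚ) : L (B * A⁻¹) • v = C34.shear 1 v := by
    have h : L A • L A⁻¹ • v = v := by rw [map_inv, smul_inv_smul]
    rw [map_mul, mul_smul, hBsmul, ← C34.shear_mulVec, ← hA, ← hLsmul, h]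
  have hTpow (n : ℕ) (v : Fin 6 → ℚ) : L ((B * A⁻¹) ^ n) • v = C34.shear n v := by
    induction n with
    | zero =>
      rw [pow_zero, map_one, one_smul]
      ext i; fin_cases i <;> simp [C34.shear]
    | succ n ih =>
      rw [pow_succ', map_mul, mul_smul, ih, hTsmul, C34.shear_shear, Nat.cast_succ, add_comm]
  have hTzpow (k : ℤ) (v : Fin 6 → ℚ) : L ((B * A⁻¹) ^ k) • v = C34.shear k v := by
    obtain ⟨n, rfl | rfl⟩ := k.eq_nat_or_neg
    · exact_mod_cast hTpow n v
    · rw [_root_.zpow_neg, zpow_natCast, map_inv, inv_smul_eq_iff, hTpow, C34.shear_shear]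
      ext i; fin_cases i <;> simp [C34.shear]
  have hB9 : B ^ 9 = 1 := hL <| eq_of_smul_eq_smul fun v : Fin 6 → ℚ => by
    rw [hBpow, C34.rot_iterate_nine, map_one, one_smul]
  have hB3 : B ^ 3 ≠ 1 := fun h => by
    have := congrFun (hBpow 3 ![1, 0, 0, 0, 0, 0]) 0
    simp [h, C34.rot] at this
  refine ⟨hB9, orderOf_eq_prime_pow (p := 3) (n := 1) (by simpa using hB3) (by simpa using hB9),
    fun h => ?_, fun ψ hψT hψB => ?_⟩
  · obtain ⟨n, hn, h⟩ := isOfFinOrder_iff_pow_eq_one.mp h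
    have := congrFun (hTpow n ![1, 0, 0, 0, 0, 0]) 1
    simp [h, C34.shear] at this
    omega
  · refine Function.Injective.of_comp (f := L) ?_
    rw [← MonoidHom.coe_comp]
    have hpow (h : Multiplicative (ZMod 9)) (hh : h ≠ 1) : ∃ j : ℕ, 1 ≤ j ∧ j ≤ 8 ∧
        ∀ v : Fin 6 → ℚ, L.comp ψ (Monoid.Coprod.inr h) • v = C34.rot^[j] v := by
      have hval : (Multiplicative.toAdd h).val ≠ 0 := fun h0 =>
        hh (Multiplicative.toAdd.injective ((ZMod.val_eq_zero _).mp h0))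
      refine ⟨(Multiplicative.toAdd h).val, by omega,
        Nat.le_of_lt_succ (ZMod.val_lt (Multiplicative.toAdd h)), fun v => ?_⟩
      have : h = Multiplicative.ofAdd (1 : ZMod 9) ^ (Multiplicative.toAdd h).val := by
        rw [← ofAdd_nsmul, nsmul_one, ZMod.natCast_zmod_val, ofAdd_toAdd]
      rw [← hBpow, ← hψB, ← map_pow, ← map_pow, ← this, MonoidHom.comp_apply]
    refine Monoid.Coprod.injective_of_ping_pong (L.comp ψ) ?_ (X := C34.table)
      (Y := {v | ∃ j : ℕ, 1 ≤ j ∧ j ≤ 8 ∧ ∃ u ∈ C34.table, C34.rot^[j] u = v})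
      C34.table_nonempty ?_ ?_ ?_ ?_
    · have : Cardinal.mk (Multiplicative (ZMod 9)) = 9 := Cardinal.mk_fin 9
      rw [this]
      norm_num
    · obtain ⟨u, hu⟩ := C34.table_nonempty
      exact ⟨_, 1, le_rfl, by norm_num, u, hu, rfl⟩
    · rw [Set.disjoint_left]
      rintro v hv ⟨j, hj, hj', u, hu, rfl⟩
      exact C34.rot_not_mem_table hj hj' hu hv
    · rintro g hg _ ⟨j, hj, hj', u, hu, rfl⟩
      have hk : Multiplicative.toAdd g ≠ 0 := fun h0 => hg (Multiplicative.toAdd.injective h0)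
      have : g = Multiplicative.ofAdd (1 : ℤ) ^ Multiplicative.toAdd g := by
        rw [← ofAdd_zsmul, smul_eq_mul, mul_one, ofAdd_toAdd]
      rw [this, MonoidHom.comp_apply, map_zpow, map_zpow, hψT, hTzpow]
      exact C34.shear_rot_mem_table hk hj hj' hu
    · intro h hh x hx
      obtain ⟨j, hj, hj', hsmul⟩ := hpow h hh
      exact ⟨j, hj, hj', x, hx, (hsmul x).symm⟩
end
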